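/- arXiv:1206.2962 — 4 statements merged into one kernel-verified Lean document; each statement's English description precedes it below -/
import Mathlib

section
/- Let i, n be natural numbers with 2 ≤ i ≤ n. Then 1 − 2^i is a unit in ℤ/2^(n+1)ℤ and its multiplicative order in the unit group (ℤ/2^(n+1)ℤ)ˣ is exactly 2^(n+1−i). -/
/-- For `2 ≤ i ≤ n`, the element `1 - 2^i` is a unit in `ℤ/2^(n+1)ℤ` of
multiplicative order exactly `2^(n+1-i)`. -/
theorem orderOf_one_sub_two_pow (i n : ℕ) (hi : 2 ≤ i) (hn : i ≤ n) :
    ∃ u : (ZMod (2 ^ (n + 1)))ˣ,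
      (u : ZMod (2 ^ (n + 1))) = 1 - 2 ^ i ∧ orderOf u = 2 ^ (n + 1 - i) := by
  have h_order : orderOf (1 - 2 ^ i : ZMod (2 ^ (n + 1))) = 2 ^ (n + 1 - i) := by
    obtain ⟨k, rfl⟩ := Nat.exists_eq_add_of_le hn
    convert! ZMod.orderOf_one_add_mul_prime_pow Nat.prime_two i (by lia) (by lia) (-1)
      (by decide) (k + 1) using 1
    · rw [show k + 1 + i = i + k + 1 by lia]
      push_cast
      ring_nf
    · congr 1
      lia
  have h_unit : IsUnit (1 - 2 ^ i : ZMod (2 ^ (n + 1))) :=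
    IsUnit.of_pow_eq_one (h_order ▸ pow_orderOf_eq_one _) (by positivity)
  obtain ⟨u, hu⟩ := h_unit
  exact ⟨u, hu, by rw [← orderOf_units, hu, h_order]⟩
end

section
/- Let n ≥ 1 and let F be a finite field with 5^(2^(n−1)) elements. Then every Sylow 2-subgroup of the projective special linear group PSL(2, F) = SL(2, F)/Z(SL(2, F)) is isomorphic to the dihedral group of order 2^(n+1). -/
section Dihedral

variable {G : Type*} [Group G] {m : ℕ} {a b : G}

/-- The homomorphism out of a dihedral group determined by elements `a` and `b` satisfying the
dihedral relations. -/
noncomputable def DihedralGroup.lift (ha : a ^ m = 1) (hb : b * b = 1)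
    (hab : b * a * b⁻¹ = a⁻¹) : DihedralGroup m →* G := by
  let φ : ZMod m →+ Additive G := ZMod.lift m ⟨zmultiplesHom (Additive G) (Additive.ofMul a), by
    simp [← ofMul_pow, ha]⟩
  have hφ (j : ZMod m) : (φ j).toMul * b = b * (φ (-j)).toMul := by
    obtain ⟨k, rfl⟩ := ZMod.intCast_surjective j
    have h : b * a ^ k * b⁻¹ = a⁻¹ ^ k := by rw [← hab, conj_zpow]
    have h' : b * (a ^ k)⁻¹ * b⁻¹ = a ^ k := by
      rw [← conj_inv, h, inv_zpow, inv_inv]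
    rw [map_neg]
    simpa [φ] using (mul_inv_eq_iff_eq_mul.mp h').symm
  exact
    { toFun := fun
        | .r i => (φ i).toMul
        | .sr i => b * (φ i).toMul
      map_one' := by
        change (φ 0).toMul = 1
        simp
      map_mul' := by
        rintro (i | i) (j | j)
        · simp [map_add]
        · simp only [DihedralGroup.r_mul_sr, ← mul_assoc, hφ]
          rw [mul_assoc, ← toMul_add, ← map_add, neg_add_eq_sub]
        · simp [map_add, mul_assoc]
        · have : b * (φ i).toMul * (b * (φ j).toMul) =
              b * ((φ i).toMul * b) * (φ j).toMul := by simp only [mul_assoc]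
          simp only [DihedralGroup.sr_mul_sr, this, hφ]
          rw [← mul_assoc b, hb, one_mul, ← toMul_add, ← map_add, neg_add_eq_sub] }

theorem DihedralGroup.lift_r (ha : a ^ m = 1) (hb : b * b = 1) (hab : b * a * b⁻¹ = a⁻¹) (k : ℤ) :
    DihedralGroup.lift ha hb hab (.r k) = a ^ k := by
  change Additive.toMul (ZMod.lift m (A := Additive G) _ (k : ZMod m)) = _
  simp

theorem DihedralGroup.lift_sr (ha : a ^ m = 1) (hb : b * b = 1) (hab : b * a * b⁻¹ = a⁻¹) (k : ℤ) :
    DihedralGroup.lift ha hb hab (.sr k) = b * a ^ k := by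
  change b * Additive.toMul (ZMod.lift m (A := Additive G) _ (k : ZMod m)) = _
  simp

theorem DihedralGroup.lift_injective (ha : a ^ m = 1) (hb : b * b = 1) (hab : b * a * b⁻¹ = a⁻¹)
    (hm : orderOf a = m) (hba : b ∉ Subgroup.zpowers a) :
    Function.Injective (DihedralGroup.lift ha hb hab) := by
  rw [injective_iff_map_eq_one]
  rintro (i | i) h <;> obtain ⟨k, rfl⟩ := ZMod.intCast_surjective i
  · rw [DihedralGroup.lift_r, ← orderOf_dvd_iff_zpow_eq_one, hm] at h
    rw [(ZMod.intCast_zmod_eq_zero_iff_dvd k m).mpr h, DihedralGroup.r_zero]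
  · rw [DihedralGroup.lift_sr] at h
    exact absurd ⟨-k, by simpa using (eq_inv_of_mul_eq_one_left h).symm⟩ hba

end Dihedral

theorem exists_odd_five_pow_two_pow (m : ℕ) :
    ∃ k, Odd k ∧ 5 ^ 2 ^ m = 2 ^ (m + 2) * k + 1 := by
  induction m with
  | zero => exact ⟨1, odd_one, by norm_num⟩
  | succ m ih =>
    obtain ⟨k, hk, h⟩ := ih
    refine ⟨2 ^ (m + 1) * k ^ 2 + k, ?_, ?_⟩
    · exact Even.add_odd ((by simp [pow_succ'] : Even (2 ^ (m + 1))).mul_right _) hk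
    · rw [pow_succ 2 m, pow_mul, h]
      ring

namespace Matrix.SpecialLinearGroup

variable {F : Type*} [Field F]

/-- The embedding of the multiplicative group of a field as the diagonal torus of `SL(2, F)`. -/
def diagonalTorus : Fˣ →* SpecialLinearGroup (Fin 2) F where
  toFun u := ⟨!![(u : F), 0; 0, (u⁻¹ : Fˣ)], by simp [Matrix.det_fin_two]⟩
  map_one' := by
    ext i j
    fin_cases i <;> fin_cases j <;> simp
  map_mul' u v := Subtype.ext <| by
    change _ = !![(u : F), 0; 0, (u⁻¹ : Fˣ)] * !![(v : F), 0; 0, (v⁻¹ : Fˣ)]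
    simp [mul_comm]

theorem coe_diagonalTorus (u : Fˣ) :
    (diagonalTorus u : Matrix (Fin 2) (Fin 2) F) = !![(u : F), 0; 0, (u⁻¹ : Fˣ)] := rfl

/-- The Weyl element of `SL(2, F)`. -/
def weyl (F : Type*) [Field F] : SpecialLinearGroup (Fin 2) F :=
  ⟨!![0, -1; 1, 0], by simp [Matrix.det_fin_two]⟩

theorem coe_weyl : (weyl F : Matrix (Fin 2) (Fin 2) F) = !![0, -1; 1, 0] := rfl

theorem weyl_mul_self : weyl F * weyl F = -1 := by
  ext i j
  fin_cases i <;> fin_cases j <;> simp [coe_weyl]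

theorem weyl_conj_diagonalTorus (u : Fˣ) :
    weyl F * diagonalTorus u * (weyl F)⁻¹ = (diagonalTorus u)⁻¹ := by
  rw [mul_inv_eq_iff_eq_mul, ← map_inv]
  ext i j
  fin_cases i <;> fin_cases j <;> simp [coe_weyl, coe_diagonalTorus]

theorem apply_one_zero_of_mem_center {A : SpecialLinearGroup (Fin 2) F}
    (hA : A ∈ Subgroup.center (SpecialLinearGroup (Fin 2) F)) : A 1 0 = 0 := by
  simpa using (congr_fun₂ (scalar_eq_self_of_mem_center hA 0) 1 0).symm

theorem neg_one_mem_center :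
    (-1 : SpecialLinearGroup (Fin 2) F) ∈ Subgroup.center (SpecialLinearGroup (Fin 2) F) :=
  Subgroup.mem_center_iff.mpr fun g ↦ by simp

theorem diagonalTorus_mem_center_iff (u : Fˣ) :
    diagonalTorus u ∈ Subgroup.center (SpecialLinearGroup (Fin 2) F) ↔ u ^ 2 = 1 := by
  constructor
  · intro h
    have := congr_fun₂ (scalar_eq_self_of_mem_center h 0) 1 1
    simp only [coe_diagonalTorus, scalar_apply, diagonal_apply_eq] at this
    have : u = u⁻¹ := Units.ext (by simpa using this)
    rw [sq, ← mul_inv_cancel u, ← this]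
  · intro h
    have : u⁻¹ = u := inv_eq_of_mul_eq_one_left (by rwa [← sq])
    refine mem_center_iff.mpr ⟨u, by simpa using congrArg Units.val h, ?_⟩
    ext i j
    fin_cases i <;> fin_cases j <;> simp [coe_diagonalTorus, this, -Units.val_inv_eq_inv_val]

theorem card_mul_card_units (n : Type*) [Fintype n] [DecidableEq n] [Nonempty n] :
    Nat.card (SpecialLinearGroup n F) * Nat.card Fˣ = Nat.card (GL n F) := by
  have hs : Function.Surjective (GeneralLinearGroup.det : GL n F →* Fˣ) :=
    GeneralLinearGroup.det_surjective
  have hr : (toGL : SpecialLinearGroup n F →* GL n F).range =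
      (GeneralLinearGroup.det : GL n F →* Fˣ).ker :=
    SetLike.coe_injective range_toGL
  have h := (GeneralLinearGroup.det : GL n F →* Fˣ).ker.card_mul_index
  rwa [Subgroup.index_ker, MonoidHom.range_eq_top.mpr hs, Subgroup.card_top, ← hr,
    Nat.card_congr (MonoidHom.ofInjective toGL_injective).toEquiv.symm] at h

theorem card_fin_two [Fintype F] :
    Nat.card (SpecialLinearGroup (Fin 2) F) =
      Fintype.card F * (Fintype.card F - 1) * (Fintype.card F + 1) := by
  have h := card_mul_card_units (F := F) (Fin 2)
  rw [card_GL_field, Nat.card_units, Nat.card_eq_fintype_card (α := F)] at h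
  have hq := Fintype.one_lt_card (α := F)
  obtain ⟨t, ht⟩ : ∃ t, Fintype.card F = t + 2 := ⟨_, (Nat.sub_add_cancel hq).symm⟩
  have h1 : (t + 2) ^ 2 - 1 = (t + 1) * (t + 3) := Nat.sub_eq_of_eq_add (by ring)
  have h2 : (t + 2) ^ 2 - (t + 2) = (t + 2) * (t + 1) := Nat.sub_eq_of_eq_add (by ring)
  simp only [Fin.prod_univ_two, Fin.val_zero, Fin.val_one, pow_zero, pow_one, ht, h1, h2] at h
  rw [ht]
  simp only [show t + 2 - 1 = t + 1 from rfl] at h ⊢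
  exact Nat.eq_of_mul_eq_mul_right (Nat.add_one_pos t) (h.trans (by ring))

theorem card_center_fin_two (h2 : (2 : F) ≠ 0) :
    Nat.card (Subgroup.center (SpecialLinearGroup (Fin 2) F)) = 2 := by
  have : IsPrimitiveRoot (-1 : F) 2 :=
    IsPrimitiveRoot.mk_of_lt _ two_pos (by simp) fun l hl hl' ↦ by
      obtain rfl : l = 1 := by lia
      rw [pow_one, Ne, neg_eq_iff_add_eq_zero, one_add_one_eq_two]
      exact h2
  rw [Nat.card_congr (center_equiv_rootsOfUnity' (0 : Fin 2)).toEquiv]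
  exact this.card_rootsOfUnity

end Matrix.SpecialLinearGroup

open Matrix.SpecialLinearGroup in
/-- For `n ≥ 1` and a finite field `F` with `5^(2^(n-1))` elements, every Sylow
`2`-subgroup of `PSL(2, F)` is dihedral of order `2^(n+1)`. -/
theorem sylow_two_psl2_dihedral (n : ℕ) (hn : 1 ≤ n) (F : Type*) [Field F]
    [Fintype F] (hF : Fintype.card F = 5 ^ (2 ^ (n - 1)))
    (S : Sylow 2 (Matrix.SpecialLinearGroup (Fin 2) F ⧸
      Subgroup.center (Matrix.SpecialLinearGroup (Fin 2) F))) :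
    Nonempty (S ≃* DihedralGroup (2 ^ n)) := by
  obtain ⟨m, rfl⟩ : ∃ m, n = m + 1 := ⟨n - 1, by lia⟩
  obtain ⟨k, hk, hq⟩ := exists_odd_five_pow_two_pow m
  rw [Nat.add_sub_cancel, hq] at hF
  have hk0 : k ≠ 0 := hk.pos.ne'
  have h2 : (2 : F) ≠ 0 := by
    intro h
    have := Nat.cast_card_eq_zero F
    rw [hF] at this
    simp [pow_succ, h] at this
  set Z := Subgroup.center (Matrix.SpecialLinearGroup (Fin 2) F)
  -- The 2-part of the order of `PSL(2, F)`.
  have hcard : (Nat.card (Matrix.SpecialLinearGroup (Fin 2) F ⧸ Z)).factorization 2 = m + 2 := by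
    have h := Z.card_eq_card_quotient_mul_card_subgroup
    rw [card_center_fin_two h2, card_fin_two, hF, Nat.add_sub_cancel] at h
    set c := (2 ^ (m + 2) * k + 1) * k * (2 ^ (m + 1) * k + 1) with hc
    have hodd (l : ℕ) : Odd (2 ^ (l + 1) * k + 1) :=
      ((by simp [pow_succ'] : Even (2 ^ (l + 1))).mul_right _).add_one
    have hc2 : ¬ 2 ∣ c := by
      rw [← even_iff_two_dvd, Nat.not_even_iff_odd]
      exact ((hodd _).mul hk).mul (hodd _)
    have h' : Nat.card (Matrix.SpecialLinearGroup (Fin 2) F ⧸ Z) = 2 ^ (m + 2) * c :=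
      Nat.eq_of_mul_eq_mul_right two_pos (h.symm.trans (by rw [hc]; ring))
    rw [h', Nat.factorization_mul (by positivity) (by rintro h; simp [h] at hc2)]
    simp [Nat.factorization_eq_zero_of_not_dvd hc2, Nat.prime_two.factorization_pow]
  obtain ⟨ζ, hζ⟩ : ∃ ζ : Fˣ, orderOf ζ = 2 ^ (m + 2) := by
    obtain ⟨g, hg⟩ := IsCyclic.exists_ofOrder_eq_natCard (α := Fˣ)
    rw [Nat.card_units, Nat.card_eq_fintype_card, hF, Nat.add_sub_cancel] at hg
    refine ⟨g ^ k, ?_⟩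
    rw [orderOf_pow_of_dvd hk0 (by simp [hg]), hg, Nat.mul_div_cancel _ hk.pos]
  set a : Matrix.SpecialLinearGroup (Fin 2) F ⧸ Z := QuotientGroup.mk (diagonalTorus ζ) with ha
  set b : Matrix.SpecialLinearGroup (Fin 2) F ⧸ Z := QuotientGroup.mk (weyl F) with hb
  have hab : b * a * b⁻¹ = a⁻¹ := by
    simp only [ha, hb, ← QuotientGroup.mk_mul, ← QuotientGroup.mk_inv, weyl_conj_diagonalTorus]
  have hbb : b * b = 1 := by
    rw [hb, ← QuotientGroup.mk_mul, weyl_mul_self, QuotientGroup.eq_one_iff]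
    exact neg_one_mem_center
  have hord : orderOf a = 2 ^ (m + 1) := by
    refine Nat.dvd_right_iff_eq.mp fun l ↦ ?_
    rw [orderOf_dvd_iff_pow_eq_one, ha, ← QuotientGroup.mk_pow, QuotientGroup.eq_one_iff,
      ← map_pow, diagonalTorus_mem_center_iff, ← pow_mul, ← orderOf_dvd_iff_pow_eq_one, hζ,
      pow_succ 2 (m + 1), Nat.mul_dvd_mul_iff_right two_pos]
  have hba : b ∉ Subgroup.zpowers a := by
    rintro ⟨l, hl⟩
    have hl : (QuotientGroup.mk (diagonalTorus (ζ ^ l)) :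
        Matrix.SpecialLinearGroup (Fin 2) F ⧸ Z) = QuotientGroup.mk (weyl F) := by
      rw [map_zpow, QuotientGroup.mk_zpow]
      exact hl
    generalize ζ ^ l = u at hl
    rw [QuotientGroup.eq, ← map_inv] at hl
    simpa [coe_diagonalTorus, coe_weyl] using apply_one_zero_of_mem_center hl
  have ham : a ^ 2 ^ (m + 1) = 1 := hord ▸ pow_orderOf_eq_one a
  let e := MonoidHom.ofInjective (DihedralGroup.lift_injective ham hbb hab hord hba)
  have hP := Nat.card_congr e.toEquiv
  rw [DihedralGroup.nat_card, ← pow_succ', ← hcard] at hP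
  exact ⟨(S.equiv (Sylow.ofCard _ hP.symm)).trans e.symm⟩
end

section
/- Let P be a finite bicyclic 2-group. Then every section of P can be generated by at most 3 elements; that is, for every subgroup H ≤ P and every normal subgroup N of H, the quotient H/N is generated by some set of at most 3 elements. -/
/-- A group is bicyclic if it is the product of two cyclic subgroups. -/
def IsBicyclic (P : Type*) [Group P] : Prop :=
  ∃ x y : P, ∀ g : P, ∃ i j : ℤ, g = x ^ i * y ^ j

namespace Subgroup

universe u
variable {G : Type u} [Group G]

/-- The subgroup generated by the squares of the elements of `K`. -/
def squares (K : Subgroup G) : Subgroup G :=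
  closure {g | ∃ k ∈ K, k ^ 2 = g}

theorem sq_mem_squares {K : Subgroup G} {k : G} (hk : k ∈ K) : k ^ 2 ∈ K.squares :=
  subset_closure ⟨k, hk, rfl⟩

theorem squares_le (K : Subgroup G) : K.squares ≤ K := by
  rw [squares, closure_le]
  rintro _ ⟨k, hk, rfl⟩
  exact K.pow_mem hk 2

theorem squares_mono {H K : Subgroup G} (h : H ≤ K) : H.squares ≤ K.squares := by
  apply closure_mono
  rintro _ ⟨k, hk, rfl⟩
  exact ⟨k, h hk, rfl⟩

theorem conj_mem_squares {K : Subgroup G} {g : G} (hg : ∀ k ∈ K, g * k * g⁻¹ ∈ K) :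
    ∀ s ∈ K.squares, g * s * g⁻¹ ∈ K.squares := by
  have : K.squares ≤ K.squares.comap (MulAut.conj g).toMonoidHom := by
    conv_lhs => rw [squares]
    rw [closure_le]
    rintro _ ⟨k, hk, rfl⟩
    simpa using sq_mem_squares (hg k hk)
  intro s hs
  simpa using this hs

theorem conj_mem_squares_of_mem {K : Subgroup G} {g s : G} (hg : g ∈ K) (hs : s ∈ K.squares) :
    g * s * g⁻¹ ∈ K.squares :=
  conj_mem_squares (fun _ hk => K.mul_mem (K.mul_mem hg hk) (K.inv_mem hg)) s hs

/-- `K` modulo its squares is an elementary abelian `2`-group. -/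
theorem exists_hom_ker_squares (K : Subgroup G) :
    ∃ (Q : Type u) (_ : CommGroup Q) (f : K →* Q),
      (∀ q : Q, q ^ 2 = 1) ∧ ∀ k : K, f k = 1 ↔ (k : G) ∈ K.squares := by
  have hn : (K.squares.subgroupOf K).Normal := by
    refine ⟨fun s hs g => ?_⟩
    rw [mem_subgroupOf] at hs ⊢
    simpa using conj_mem_squares_of_mem g.2 hs
  have hsq : ∀ q : K ⧸ K.squares.subgroupOf K, q ^ 2 = 1 := by
    intro q
    obtain ⟨k, rfl⟩ := QuotientGroup.mk_surjective q
    rw [← QuotientGroup.mk_pow, QuotientGroup.eq_one_iff, mem_subgroupOf]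
    exact sq_mem_squares k.2
  have hinv : ∀ q : K ⧸ K.squares.subgroupOf K, q⁻¹ = q := fun q => by
    rw [inv_eq_iff_mul_eq_one, ← sq, hsq]
  refine ⟨K ⧸ K.squares.subgroupOf K, { mul_comm := fun a b => ?_ },
    QuotientGroup.mk' _, hsq, fun k => ?_⟩
  · rw [← hinv (a * b), mul_inv_rev, hinv, hinv]
  · rw [QuotientGroup.mk'_apply, QuotientGroup.eq_one_iff, mem_subgroupOf]

theorem _root_.zpow_of_even_of_sq_eq_one {q : G} (h : q ^ 2 = 1) {i : ℤ} (hi : Even i) :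
    q ^ i = 1 := by
  obtain ⟨k, rfl⟩ := even_iff_exists_two_mul.1 hi
  rw [zpow_mul, zpow_ofNat, h, one_zpow]

theorem _root_.zpow_of_odd_of_sq_eq_one {q : G} (h : q ^ 2 = 1) {i : ℤ} (hi : Odd i) :
    q ^ i = q := by
  obtain ⟨k, rfl⟩ := hi
  rw [zpow_add, zpow_mul, zpow_ofNat, h, one_zpow, one_mul, zpow_one]

theorem _root_.zpow_mul_zpow_cases {Q : Type*} [Group Q] {p q : Q} (hp : p ^ 2 = 1)
    (hq : q ^ 2 = 1) (i j : ℤ) :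
    p ^ i * q ^ j = 1 ∨ p ^ i * q ^ j = p ∨ p ^ i * q ^ j = q ∨ p ^ i * q ^ j = p * q := by
  rcases i.even_or_odd with hi | hi <;> rcases j.even_or_odd with hj | hj <;>
    simp [zpow_of_even_of_sq_eq_one, zpow_of_odd_of_sq_eq_one, *]

theorem exists_map_eq_of_closure_pair {Q : Type*} [CommGroup Q] {K : Subgroup G} {u v : G}
    (hu : u ∈ K) (hv : v ∈ K) (hK : K ≤ closure {u, v}) (f : K →* Q) (k : K) :
    ∃ i j : ℤ, f k = f ⟨u, hu⟩ ^ i * f ⟨v, hv⟩ ^ j := by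
  have h : closure {(⟨u, hu⟩ : K), ⟨v, hv⟩} = ⊤ := by
    rw [eq_top_iff]
    intro g _
    have hg := hK g.2
    have him : ({u, v} : Set G) = K.subtype '' {⟨u, hu⟩, ⟨v, hv⟩} := by simp [Set.image_pair]
    rw [him, ← MonoidHom.map_closure] at hg
    obtain ⟨g', hg', he⟩ := hg
    rwa [← Subtype.ext he]
  have hk : f k ∈ (closure {(⟨u, hu⟩ : K), ⟨v, hv⟩}).map f :=
    mem_map_of_mem f (h ▸ mem_top k)
  rw [MonoidHom.map_closure, Set.image_pair, mem_closure_pair] at hk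
  obtain ⟨i, j, h⟩ := hk
  exact ⟨i, j, h.symm⟩

theorem mem_squares_cases {K : Subgroup G} {u v : G}
    (hu : u ∈ K) (hv : v ∈ K) (hK : K ≤ closure {u, v}) {g : G} (hg : g ∈ K) :
    g ∈ K.squares ∨ u⁻¹ * g ∈ K.squares ∨ v⁻¹ * g ∈ K.squares ∨
      (u * v)⁻¹ * g ∈ K.squares := by
  obtain ⟨Q, _, f, hsq, hf⟩ := K.exists_hom_ker_squares
  obtain ⟨i, j, h⟩ := exists_map_eq_of_closure_pair hu hv hK f ⟨g, hg⟩
  have key : ∀ (w : K), f ⟨g, hg⟩ = f w → (w : G)⁻¹ * g ∈ K.squares := fun w hw => by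
    have := (hf (w⁻¹ * ⟨g, hg⟩)).1 (by rw [map_mul, map_inv, hw, inv_mul_cancel])
    simpa using this
  rcases zpow_mul_zpow_cases (hsq (f ⟨u, hu⟩)) (hsq (f ⟨v, hv⟩)) i j with h' | h' | h' | h' <;>
    rw [← h] at h'
  · exact Or.inl ((hf ⟨g, hg⟩).1 h')
  · exact Or.inr (Or.inl (key _ h'))
  · exact Or.inr (Or.inr (Or.inl (key _ h')))
  · rw [← map_mul] at h'
    exact Or.inr (Or.inr (Or.inr (key _ h')))

theorem _root_.IsPGroup.index_eq_two_of_isCoatom [Finite G] (hG : IsPGroup 2 G)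
    {M : Subgroup G} (hM : IsCoatom M) : M.index = 2 := by
  obtain ⟨n, hn⟩ := IsPGroup.iff_card.1 hG
  obtain ⟨m, hm⟩ := IsPGroup.iff_card.1 (hG.to_subgroup M)
  have hmn : m < n := by
    by_contra! h
    apply hM.1
    rw [← card_eq_iff_eq_top]
    apply le_antisymm (card_le_card_group M)
    rw [hn, hm]
    exact Nat.pow_le_pow_right two_pos h
  obtain ⟨M', hM', hle⟩ := Sylow.exists_subgroup_card_pow_succ (p := 2)
    (hn ▸ pow_dvd_pow 2 hmn) hm
  have htop : M' = ⊤ := by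
    refine (hM.le_iff.1 hle).resolve_right ?_
    rintro rfl
    rw [hm] at hM'
    exact absurd (Nat.pow_right_injective le_rfl hM') (by omega)
  have h := M.card_mul_index
  rw [← card_top (G := G), ← htop, hM', hm, pow_succ] at h
  exact Nat.eq_of_mul_eq_mul_left (by positivity) h

/-- The squares of a finite `2`-group are nongenerators. -/
theorem le_of_le_sup_squares [Finite G] (hG : IsPGroup 2 G) {H K : Subgroup G} (hHK : H ≤ K)
    (h : K ≤ H ⊔ K.squares) : K ≤ H := by
  by_contra hn
  obtain ⟨M, hM, hle⟩ :=
    (eq_top_or_exists_le_coatom (H.subgroupOf K)).resolve_left (by rwa [subgroupOf_eq_top])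
  have hi := (hG.to_subgroup K).index_eq_two_of_isCoatom hM
  apply hM.1
  rw [eq_top_iff]
  intro k _
  have hk : (k : G) ∈ M.map K.subtype := by
    refine (sup_le ?_ ?_ : H ⊔ K.squares ≤ _) (h k.2)
    · intro g hg
      exact ⟨⟨g, hHK hg⟩, hle (mem_subgroupOf.2 hg), rfl⟩
    · rw [squares, closure_le]
      rintro _ ⟨g, hg, rfl⟩
      exact ⟨⟨g, hg⟩ ^ 2, sq_mem_of_index_two hi _, rfl⟩
  obtain ⟨k', hk', he⟩ := hk
  rwa [← Subtype.ext he]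

theorem closure_pair_le {K : Subgroup G} {u v : G} (hu : u ∈ K) (hv : v ∈ K) :
    closure {u, v} ≤ K := by
  rw [closure_le]
  rintro _ (rfl | rfl)
  exacts [hu, hv]

/-- Burnside basis argument: an element outside the squares of a `2`-generated `2`-group is part
of a generating pair. -/
theorem exists_closure_pair_of_notMem_squares [Finite G] (hG : IsPGroup 2 G) {K : Subgroup G}
    {u v t : G} (hK : K = closure {u, v}) (ht : t ∈ K) (hts : t ∉ K.squares) :
    ∃ w, K = closure {t, w} := by
  have hu : u ∈ K := hK ▸ subset_closure (by simp)
  have hv : v ∈ K := hK ▸ subset_closure (by simp)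
  have key : ∀ w ∈ K, (∀ M : Subgroup G, K.squares ≤ M → t ∈ M → w ∈ M → u ∈ M ∧ v ∈ M) →
      K = closure {t, w} := by
    intro w hw h
    have hle := closure_pair_le ht hw
    refine le_antisymm (le_of_le_sup_squares hG hle ?_) hle
    obtain ⟨h1, h2⟩ := h (closure {t, w} ⊔ K.squares) le_sup_right
      (le_sup_left (a := closure {t, w}) (subset_closure (by simp)))
      (le_sup_left (a := closure {t, w}) (subset_closure (by simp)))
    conv_lhs => rw [hK]
    exact closure_pair_le h1 h2
  rcases mem_squares_cases hu hv hK.le ht with h | h | h | h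
  · exact absurd h hts
  · refine ⟨v, key v hv fun M hM htM hvM => ⟨?_, hvM⟩⟩
    simpa using M.mul_mem htM (M.inv_mem (hM h))
  · refine ⟨u, key u hu fun M hM htM huM => ⟨huM, ?_⟩⟩
    simpa using M.mul_mem htM (M.inv_mem (hM h))
  · refine ⟨v, key v hv fun M hM htM hvM => ⟨?_, hvM⟩⟩
    simpa using M.mul_mem (M.mul_mem htM (M.inv_mem (hM h))) (M.inv_mem hvM)

/-- A proper subgroup of a `2`-generated `2`-group `K` has image of order at most two
modulo the squares of `K`. -/
theorem mem_squares_or_inv_mul_mem [Finite G] (hG : IsPGroup 2 G) {H K : Subgroup G} {u v h g : G}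
    (hK : K = closure {u, v}) (hHK : H ≤ K) (hne : ¬ K ≤ H) (hh : h ∈ H) (hhs : h ∉ K.squares)
    (hg : g ∈ H) : g ∈ K.squares ∨ h⁻¹ * g ∈ K.squares := by
  obtain ⟨w, hw⟩ := exists_closure_pair_of_notMem_squares hG hK (hHK hh) hhs
  have hwK : w ∈ K := hw ▸ subset_closure (by simp)
  have hwn : w ∉ H ⊔ K.squares := fun hc => hne <| le_of_le_sup_squares hG hHK <|
    hw.le.trans (closure_pair_le (le_sup_left (a := H) hh) hc)
  rcases mem_squares_cases (hHK hh) hwK hw.le (hHK hg) with h1 | h1 | h1 | h1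
  · exact Or.inl h1
  · exact Or.inr h1
  · refine absurd ?_ hwn
    simpa using mul_mem (le_sup_left (a := H) hg) (inv_mem (le_sup_right (a := H) h1))
  · refine absurd ?_ hwn
    simpa [mul_assoc] using mul_mem (inv_mem (le_sup_left (b := K.squares) hh))
      (mul_mem (le_sup_left (a := H) hg) (inv_mem (le_sup_right (a := H) h1)))

/-- `K` is the product of the cyclic subgroups generated by its elements `a` and `b`. -/
structure IsZPowersMul (K : Subgroup G) (a b : G) : Prop where
  left_mem : a ∈ K
  right_mem : b ∈ K
  exists_eq : ∀ g ∈ K, ∃ i j : ℤ, g = a ^ i * b ^ j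

theorem IsZPowersMul.eq_closure {K : Subgroup G} {a b : G} (h : K.IsZPowersMul a b) :
    K = closure {a, b} := by
  refine le_antisymm (fun g hg => ?_) (closure_pair_le h.left_mem h.right_mem)
  obtain ⟨i, j, rfl⟩ := h.exists_eq g hg
  exact mul_mem (zpow_mem (subset_closure (by simp)) _) (zpow_mem (subset_closure (by simp)) _)

section NotCyclic

variable [Finite G] {K : Subgroup G} {a b : G}

theorem notMem_squares_left (hG : IsPGroup 2 G) (h : K = closure {a, b})
    (hc : ∀ g, K ≠ zpowers g) : a ∉ K.squares := fun ha => by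
  have hb : zpowers b ≤ K := zpowers_le.2 (h ▸ subset_closure (by simp))
  refine hc b (le_antisymm (le_of_le_sup_squares hG hb ?_) hb)
  exact h.le.trans (closure_pair_le (le_sup_right (a := zpowers b) ha)
    (le_sup_left (a := zpowers b) (mem_zpowers b)))

theorem notMem_squares_right (hG : IsPGroup 2 G) (h : K = closure {a, b})
    (hc : ∀ g, K ≠ zpowers g) : b ∉ K.squares :=
  notMem_squares_left (b := a) hG (by rw [h, Set.pair_comm]) hc

theorem mul_notMem_squares (hG : IsPGroup 2 G) (h : K = closure {a, b})
    (hc : ∀ g, K ≠ zpowers g) : a * b ∉ K.squares := by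
  refine notMem_squares_left (b := b) hG (h.trans (le_antisymm ?_ ?_)) hc
  · have hab : a * b ∈ closure {a * b, b} := subset_closure (by simp)
    have hb : b ∈ closure {a * b, b} := subset_closure (by simp)
    exact closure_pair_le (by simpa using mul_mem hab (inv_mem hb)) hb
  · have ha : a ∈ closure {a, b} := subset_closure (by simp)
    have hb : b ∈ closure {a, b} := subset_closure (by simp)
    exact closure_pair_le (mul_mem ha hb) hb

theorem even_and_even_of_mem_squares (hG : IsPGroup 2 G) (h : K = closure {a, b})
    (hc : ∀ g, K ≠ zpowers g) {i j : ℤ} (hij : a ^ i * b ^ j ∈ K.squares) : Even i ∧ Even j := by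
  have ha : a ∈ K := h ▸ subset_closure (by simp)
  have hb : b ∈ K := h ▸ subset_closure (by simp)
  obtain ⟨Q, _, f, hsq, hf⟩ := K.exists_hom_ker_squares
  have h0 := (hf (⟨a, ha⟩ ^ i * ⟨b, hb⟩ ^ j)).2 (by simpa using hij)
  have h1 := (hf ⟨a, ha⟩).not.2 (notMem_squares_left hG h hc)
  have h2 := (hf ⟨b, hb⟩).not.2 (notMem_squares_right hG h hc)
  have h3 := (hf (⟨a, ha⟩ * ⟨b, hb⟩)).not.2 (by simpa using mul_notMem_squares hG h hc)
  rw [map_mul, map_zpow, map_zpow] at h0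
  rw [map_mul] at h3
  rcases i.even_or_odd with hi | hi <;> rcases j.even_or_odd with hj | hj <;>
    simp_all [zpow_of_even_of_sq_eq_one, zpow_of_odd_of_sq_eq_one]

theorem IsZPowersMul.squares (hG : IsPGroup 2 G) (h : K.IsZPowersMul a b)
    (hc : ∀ g, K ≠ zpowers g) : K.squares.IsZPowersMul (a ^ 2) (b ^ 2) := by
  refine ⟨sq_mem_squares h.left_mem, sq_mem_squares h.right_mem, fun g hg => ?_⟩
  obtain ⟨i, j, rfl⟩ := h.exists_eq g (K.squares_le hg)
  obtain ⟨hi, hj⟩ := even_and_even_of_mem_squares hG h.eq_closure hc hg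
  obtain ⟨i, rfl⟩ := even_iff_exists_two_mul.1 hi
  obtain ⟨j, rfl⟩ := even_iff_exists_two_mul.1 hj
  exact ⟨i, j, by rw [zpow_mul, zpow_mul, zpow_ofNat, zpow_ofNat]⟩

end NotCyclic

section ConjugationOnFactors

variable {x y : G}

/-- `y ^ 2` centralizes a normal Klein four-group `{1, s, t, s * t}` whose element `t` is fixed
by `y`. -/
theorem commute_sq_of_commute {s t : G} (ht : t ^ 2 = 1) (hs1 : s ≠ 1)
    (hs : s ≠ t) (hyt : Commute y t)
    (hy : y * s * y⁻¹ = 1 ∨ y * s * y⁻¹ = s ∨ y * s * y⁻¹ = t ∨ y * s * y⁻¹ = s * t) :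
    Commute (y ^ 2) s := by
  have hyt' : y * t * y⁻¹ = t := by rw [hyt.eq, mul_inv_cancel_right]
  rcases hy with h | h | h | h
  · exact absurd (conj_eq_one_iff.1 h) hs1
  · exact Commute.pow_left (mul_inv_eq_iff_eq_mul.1 h) 2
  · exact absurd (mul_left_cancel (mul_right_cancel (h.trans hyt'.symm))) hs
  · have h2 : y * (y * s * y⁻¹) * y⁻¹ = s := by
      calc y * (y * s * y⁻¹) * y⁻¹ = y * (s * t) * y⁻¹ := by rw [h]
        _ = (y * s * y⁻¹) * (y * t * y⁻¹) := conj_mul.symm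
        _ = s * t ^ 2 := by rw [h, hyt', mul_assoc, sq]
        _ = s := by rw [ht, mul_one]
    change y ^ 2 * s = s * y ^ 2
    rw [← mul_inv_eq_iff_eq_mul]
    simpa only [sq, mul_inv_rev, mul_assoc] using h2

/-- If `b` is fixed by `x` up to an element `z` of order at most two which commutes with `b` and
`x`, then `b` is centralized by `x ^ 2`. -/
theorem commute_sq_of_conj_eq_mul {b z : G} (h : x * b * x⁻¹ = b * z) (hz : z ^ 2 = 1)
    (hxz : Commute x z) : Commute (x ^ 2) b := by
  change x ^ 2 * b = b * x ^ 2
  have h' : x * b = b * z * x := mul_inv_eq_iff_eq_mul.1 h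
  calc x ^ 2 * b = x * (x * b) := by rw [sq, mul_assoc]
    _ = x * (b * z * x) := by rw [h']
    _ = x * b * (z * x) := by simp only [mul_assoc]
    _ = b * z * x * (z * x) := by rw [h']
    _ = b * z * (x * z) * x := by simp only [mul_assoc]
    _ = b * z ^ 2 * x ^ 2 := by rw [hxz.eq]; simp only [mul_assoc, sq]
    _ = b * x ^ 2 := by rw [hz, mul_one]

/-- Two elements `x` and `y` cannot induce two distinct transvections on the four-group
`{1, x ^ 2, y ^ 2, x ^ 2 * y ^ 2}` if it contains `(x * y) ^ 2`. -/
theorem not_conj_eq_mul_and_conj_eq_mul (hA : (x ^ 2) ^ 2 = 1)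
    (hB1 : y ^ 2 ≠ 1) (hxy : Commute ((x * y) ^ 2) (x ^ 2))
    (hx : x * y ^ 2 * x⁻¹ = x ^ 2 * y ^ 2) (hy : y * x ^ 2 * y⁻¹ = x ^ 2 * y ^ 2) : False := by
  have hx' : x * y ^ 2 = x ^ 2 * y ^ 2 * x := mul_inv_eq_iff_eq_mul.1 hx
  have hy' : y * x ^ 2 = x ^ 2 * y ^ 2 * y := mul_inv_eq_iff_eq_mul.1 hy
  have h1 : x * y * x ^ 2 = y ^ 2 * (x * y) := by
    calc x * y * x ^ 2 = x * (y * x ^ 2) := by rw [mul_assoc]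
      _ = x ^ 2 * (x * y ^ 2) * y := by rw [hy']; group
      _ = (x ^ 2) ^ 2 * y ^ 2 * (x * y) := by rw [hx']; group
      _ = y ^ 2 * (x * y) := by rw [hA, one_mul]
  have h2 : x * y * y ^ 2 = x ^ 2 * y ^ 2 * (x * y) := by
    calc x * y * y ^ 2 = x * y ^ 2 * y := by group
      _ = x ^ 2 * y ^ 2 * (x * y) := by rw [hx', mul_assoc]
  have h3 : (x * y) ^ 2 * x ^ 2 = x ^ 2 * y ^ 2 * (x * y) ^ 2 := by
    calc (x * y) ^ 2 * x ^ 2 = x * y * (x * y * x ^ 2) := by rw [sq (x * y), mul_assoc]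
      _ = x * y * y ^ 2 * (x * y) := by rw [h1, mul_assoc (x * y)]
      _ = x ^ 2 * y ^ 2 * (x * y) ^ 2 := by rw [h2, sq (x * y), mul_assoc]
  rw [hxy.eq] at h3
  exact hB1 (by simpa using mul_right_cancel h3)

/-- If `x` fixes `y ^ 2` modulo the normal Klein four-group `{1, x ^ 4, y ^ 4, x ^ 4 * y ^ 4}`,
then `x ^ 2` and `y ^ 2` commute. -/
theorem commute_sq_sq_of_conj {L : Subgroup G} [L.Normal] (hL : ∀ z ∈ L, z ^ 2 = 1)
    (hxL : (x ^ 2) ^ 2 ∈ L) (hyL : (y ^ 2) ^ 2 ∈ L)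
    (hLxy : ∀ z ∈ L, z = 1 ∨ z = (x ^ 2) ^ 2 ∨ z = (y ^ 2) ^ 2 ∨ z = (x ^ 2) ^ 2 * (y ^ 2) ^ 2)
    (hx1 : (x ^ 2) ^ 2 ≠ 1) (hxy1 : (x ^ 2) ^ 2 ≠ (y ^ 2) ^ 2)
    (h : (y ^ 2)⁻¹ * (x * y ^ 2 * x⁻¹) ∈ L) : Commute (x ^ 2) (y ^ 2) := by
  have comm : ∀ g, Commute g ((x ^ 2) ^ 2) → Commute g ((y ^ 2) ^ 2) → ∀ z ∈ L, Commute g z := by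
    intro g h1 h2 z hz
    rcases hLxy z hz with rfl | rfl | rfl | rfl
    exacts [Commute.one_right g, h1, h2, h1.mul_right h2]
  have hy : Commute (y ^ 2) ((x ^ 2) ^ 2) := commute_sq_of_commute (hL _ hyL) hx1 hxy1
    (((Commute.refl y).pow_right 2).pow_right 2) (hLxy _ (Normal.conj_mem ‹_› _ hxL _))
  set z := (y ^ 2)⁻¹ * (x * y ^ 2 * x⁻¹) with hz
  have hb : x * y ^ 2 * x⁻¹ = y ^ 2 * z := by rw [hz, mul_inv_cancel_left]
  have hbz : Commute (y ^ 2) z := comm _ hy ((Commute.refl _).pow_right 2) z h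
  refine commute_sq_of_conj_eq_mul hb (hL z h) (comm x ?_ ?_ z h)
  · exact ((Commute.refl x).pow_right 2).pow_right 2
  · change x * _ = _ * x
    rw [← mul_inv_eq_iff_eq_mul, ← conj_pow, hb, hbz.mul_pow, hL z h, mul_one]

theorem conj_cases_of_normal {Q : Type*} [Group Q] {X Y : Q} {K : Subgroup Q} [K.Normal]
    (hK : ∀ k ∈ K, k = 1 ∨ k = X ^ 2 ∨ k = Y ^ 2 ∨ k = X ^ 2 * Y ^ 2) (hY : Y ^ 2 ∈ K)
    (hY1 : Y ^ 2 ≠ 1) (hXY : X ^ 2 ≠ Y ^ 2) :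
    X * Y ^ 2 * X⁻¹ = Y ^ 2 ∨ X * Y ^ 2 * X⁻¹ = X ^ 2 * Y ^ 2 := by
  rcases hK _ (Normal.conj_mem ‹_› _ hY X) with h | h | h | h
  · exact absurd (conj_eq_one_iff.1 h) hY1
  · refine absurd ?_ hXY
    have h' : X * X ^ 2 * X⁻¹ = X ^ 2 := by group
    exact mul_left_cancel (mul_right_cancel (h'.trans h.symm))
  · exact Or.inl h
  · exact Or.inr h

/-- In a group with normal subgroups `L ≤ K` such that `L` and `K / L` are Klein four-groups
generated by the images of `x ^ 4, y ^ 4` and `x ^ 2, y ^ 2` respectively, and such that `K`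
contains all squares, the elements `x ^ 2` and `y ^ 2` commute. -/
theorem commute_sq_sq {K L : Subgroup G} [K.Normal] [L.Normal]
    (hK : ∀ g, g ^ 2 ∈ K) (hKL : ∀ k ∈ K, k ^ 2 ∈ L) (hL : ∀ z ∈ L, z ^ 2 = 1)
    (hKxy : ∀ k ∈ K, k ∈ L ∨ (x ^ 2)⁻¹ * k ∈ L ∨ (y ^ 2)⁻¹ * k ∈ L ∨ (x ^ 2 * y ^ 2)⁻¹ * k ∈ L)
    (hLxy : ∀ z ∈ L, z = 1 ∨ z = (x ^ 2) ^ 2 ∨ z = (y ^ 2) ^ 2 ∨ z = (x ^ 2) ^ 2 * (y ^ 2) ^ 2)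
    (hx : x ^ 2 ∉ L) (hy : y ^ 2 ∉ L) (hxy : x ^ 2 * y ^ 2 ∉ L)
    (hx1 : (x ^ 2) ^ 2 ≠ 1) (hy1 : (y ^ 2) ^ 2 ≠ 1) (hxy1 : (x ^ 2) ^ 2 * (y ^ 2) ^ 2 ≠ 1) :
    Commute (x ^ 2) (y ^ 2) := by
  have hxL := hKL _ (hK x)
  have hyL := hKL _ (hK y)
  have comm : ∀ {Q : Type u} [Group Q] {s t : Q}, s ^ 2 = 1 → t ^ 2 = 1 → (s * t) ^ 2 = 1 →
      Commute s t := by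
    intro Q _ s t h1 h2 h0
    rw [sq, mul_eq_one_iff_eq_inv] at h0 h1 h2
    rw [mul_inv_rev, ← h1, ← h2] at h0
    exact h0
  have hne : (x ^ 2) ^ 2 ≠ (y ^ 2) ^ 2 := fun h => hxy1 (by rw [← h, ← sq, hL _ hxL])
  have hst := comm (hL _ hxL) (hL _ hyL) (hL _ (L.mul_mem hxL hyL))
  let q := QuotientGroup.mk' L
  have hq : ∀ g, q g = 1 ↔ g ∈ L := fun g => QuotientGroup.eq_one_iff g
  have hq2 : ∀ k ∈ K, q k ^ 2 = 1 := fun k hk => by rw [← map_pow, hq]; exact hKL k hk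
  have hAB : Commute (q x ^ 2) (q y ^ 2) := by
    simp only [← map_pow]
    refine comm (hq2 _ (hK x)) (hq2 _ (hK y)) ?_
    rw [← map_mul]
    exact hq2 _ (K.mul_mem (hK x) (hK y))
  have hcases : ∀ k ∈ K.map q,
      k = 1 ∨ k = q x ^ 2 ∨ k = q y ^ 2 ∨ k = q x ^ 2 * q y ^ 2 := by
    rintro _ ⟨k, hk, rfl⟩
    simpa only [← hq, map_mul, map_inv, inv_mul_eq_one, map_pow, eq_comm (b := q k)] using hKxy k hk
  have hcases' : ∀ k ∈ K.map q,
      k = 1 ∨ k = q y ^ 2 ∨ k = q x ^ 2 ∨ k = q y ^ 2 * q x ^ 2 := by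
    intro k hk
    rw [← hAB.eq, or_left_comm (a := k = q y ^ 2)]
    exact hcases k hk
  have : (K.map q).Normal := Normal.map ‹_› q (QuotientGroup.mk'_surjective L)
  rw [← hq, map_pow] at hx hy
  rw [← hq, map_mul, map_pow, map_pow] at hxy
  have hxK : q x ^ 2 ∈ K.map q := map_pow q x 2 ▸ mem_map_of_mem q (hK x)
  have hyK : q y ^ 2 ∈ K.map q := map_pow q y 2 ▸ mem_map_of_mem q (hK y)
  have hqx : (q x ^ 2) ^ 2 = 1 := by rw [← map_pow]; exact hq2 _ (hK x)
  have hqne : q x ^ 2 ≠ q y ^ 2 := fun h => hxy (by rw [← h, ← sq, hqx])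
  rcases conj_cases_of_normal hcases hyK hy hqne with h1 | h1
  · refine commute_sq_sq_of_conj hL hxL hyL hLxy hx1 hne ?_
    rw [← hq]
    simp only [map_mul, map_inv, map_pow]
    rw [h1, inv_mul_cancel]
  rcases conj_cases_of_normal hcases' hxK hx hqne.symm with h2 | h2
  · refine (commute_sq_sq_of_conj hL hyL hxL (fun z hz => ?_) hy1 hne.symm ?_).symm
    · rw [← hst.eq, or_left_comm (a := z = (y ^ 2) ^ 2)]
      exact hLxy z hz
    · rw [← hq]
      simp only [map_mul, map_inv, map_pow]
      rw [h2, inv_mul_cancel]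
  refine (not_conj_eq_mul_and_conj_eq_mul hqx hy ?_ h1 (h2.trans hAB.eq.symm)).elim
  rcases hcases _ (mem_map_of_mem q (hK (x * y))) with h | h | h | h <;>
    rw [map_pow, map_mul] at h <;> rw [h]
  · exact Commute.one_left _
  · exact hAB.symm
  · exact (Commute.refl _).mul_left hAB.symm

end ConjugationOnFactors

/-- `commute_sq_sq` in a bicyclic `2`-group whose first two iterated square subgroups are not
cyclic. -/
theorem IsZPowersMul.commutator_mem_squares [Finite G] (hG : IsPGroup 2 G) {P : Subgroup G}
    {x y : G} (h : P.IsZPowersMul x y) (hP : ∀ g, P ≠ zpowers g)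
    (hK : ∀ g, P.squares ≠ zpowers g) (hL : ∀ g, P.squares.squares ≠ zpowers g) :
    (y ^ 2 * x ^ 2)⁻¹ * (x ^ 2 * y ^ 2) ∈ P.squares.squares.squares := by
  have hKbi := h.squares hG hP
  have hLbi := hKbi.squares hG hK
  set K := P.squares with hKdef
  set L := K.squares with hLdef
  have hconjK : ∀ g ∈ P, ∀ k ∈ K, g * k * g⁻¹ ∈ K := fun g hg k hk =>
    conj_mem_squares_of_mem hg hk
  have hconjL : ∀ g ∈ P, ∀ k ∈ L, g * k * g⁻¹ ∈ L := fun g hg => conj_mem_squares (hconjK g hg)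
  have hN : (L.squares.subgroupOf P).Normal :=
    ⟨fun n hn g => conj_mem_squares (hconjL g g.2) n hn⟩
  have hK' : (K.subgroupOf P).Normal := ⟨fun n hn g => hconjK g g.2 n hn⟩
  have hL' : (L.subgroupOf P).Normal := ⟨fun n hn g => hconjL g g.2 n hn⟩
  let f := QuotientGroup.mk' (L.squares.subgroupOf P)
  have hf : ∀ p : P, f p = 1 ↔ (p : G) ∈ L.squares := fun p => QuotientGroup.eq_one_iff p
  have hsurj : Function.Surjective f := QuotientGroup.mk'_surjective _
  have := hK'.map f hsurj
  have := hL'.map f hsurj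
  have hmemL : ∀ p : P, f p ∈ (L.subgroupOf P).map f ↔ (p : G) ∈ L := by
    refine fun p => ⟨?_, fun hp => mem_map_of_mem f hp⟩
    rintro ⟨l, hl, he⟩
    have h1 : f (l⁻¹ * p) = 1 := by rw [map_mul, map_inv, he, inv_mul_cancel]
    rw [hf] at h1
    simpa using mul_mem (show (l : G) ∈ L from hl) (L.squares_le h1)
  let X : P := ⟨x, h.left_mem⟩
  let Y : P := ⟨y, h.right_mem⟩
  have key : Commute (f X ^ 2) (f Y ^ 2) := by
    apply commute_sq_sq (K := (K.subgroupOf P).map f) (L := (L.subgroupOf P).map f)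
    · intro g
      obtain ⟨p, rfl⟩ := hsurj g
      exact ⟨p ^ 2, sq_mem_squares p.2, map_pow f p 2⟩
    · rintro _ ⟨k, hk, rfl⟩
      exact ⟨k ^ 2, sq_mem_squares (show (k : G) ∈ K from hk), map_pow f k 2⟩
    · rintro _ ⟨k, hk, rfl⟩
      rw [← map_pow, hf]
      exact sq_mem_squares (show (k : G) ∈ L from hk)
    · rintro _ ⟨k, hk, rfl⟩
      simp only [← map_pow, ← map_mul, ← map_inv, hmemL]
      exact mem_squares_cases hKbi.left_mem hKbi.right_mem hKbi.eq_closure.le hk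
    · rintro _ ⟨k, hk, rfl⟩
      have hc := mem_squares_cases hLbi.left_mem hLbi.right_mem hLbi.eq_closure.le hk
      have he : ∀ w : P, f k = f w ↔ (w : G)⁻¹ * k ∈ L.squares := fun w => by
        rw [eq_comm, ← inv_mul_eq_one, ← map_inv, ← map_mul, hf]; rfl
      simp only [← map_pow, ← map_mul, he, hf]
      exact hc
    · rw [← map_pow, hmemL]
      exact notMem_squares_left hG hKbi.eq_closure hK
    · rw [← map_pow, hmemL]
      exact notMem_squares_right hG hKbi.eq_closure hK
    · rw [← map_pow, ← map_pow, ← map_mul, hmemL]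
      exact mul_notMem_squares hG hKbi.eq_closure hK
    · rw [← map_pow, ← map_pow, Ne, hf]
      exact notMem_squares_left hG hLbi.eq_closure hL
    · rw [← map_pow, ← map_pow, Ne, hf]
      exact notMem_squares_right hG hLbi.eq_closure hL
    · simp only [← map_pow, ← map_mul, Ne, hf]
      exact mul_notMem_squares hG hLbi.eq_closure hL
  have hfin := (hf ((Y ^ 2 * X ^ 2)⁻¹ * (X ^ 2 * Y ^ 2))).1 (by
    simp only [map_mul, map_inv, map_pow]
    rw [key.eq, inv_mul_cancel])
  exact hfin

/-- If `a` and `b` commute modulo the squares of `K.squares`, then squaring is injective from `K`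
modulo `K.squares` to `K.squares` modulo its squares. -/
theorem IsZPowersMul.sq_notMem_squares_squares [Finite G] (hG : IsPGroup 2 G) {K : Subgroup G}
    {a b : G} (h : K.IsZPowersMul a b) (hK : ∀ g, K ≠ zpowers g)
    (hL : ∀ g, K.squares ≠ zpowers g) (hab : (b * a)⁻¹ * (a * b) ∈ K.squares.squares)
    {g : G} (hg : g ∈ K) (hgs : g ∉ K.squares) : g ^ 2 ∉ K.squares.squares := by
  intro hg2
  have hN : (K.squares.squares.subgroupOf K).Normal :=
    ⟨fun n hn g => conj_mem_squares (fun _ => conj_mem_squares_of_mem g.2) n hn⟩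
  let f := QuotientGroup.mk' (K.squares.squares.subgroupOf K)
  have hf : ∀ k : K, f k = 1 ↔ (k : G) ∈ K.squares.squares := fun k => QuotientGroup.eq_one_iff k
  let A : K := ⟨a, h.left_mem⟩
  let B : K := ⟨b, h.right_mem⟩
  have hcomm : Commute (f A) (f B) := by
    have := (hf ((B * A)⁻¹ * (A * B))).2 hab
    rw [map_mul, map_inv, inv_mul_eq_one, map_mul, map_mul] at this
    exact this.symm
  obtain ⟨i, j, rfl⟩ := h.exists_eq g hg
  have h1 : f ((A ^ 2) ^ i * (B ^ 2) ^ j) = 1 := by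
    rw [← (hf ((A ^ i * B ^ j) ^ 2)).2 hg2]
    simp only [map_mul, map_pow, map_zpow]
    rw [(hcomm.zpow_zpow i j).mul_pow]
    simp only [← zpow_natCast, ← zpow_mul, mul_comm]
  obtain ⟨hi, hj⟩ := even_and_even_of_mem_squares hG (h.squares hG hK).eq_closure hL ((hf _).1 h1)
  obtain ⟨i, rfl⟩ := even_iff_exists_two_mul.1 hi
  obtain ⟨j, rfl⟩ := even_iff_exists_two_mul.1 hj
  apply hgs
  rw [zpow_mul, zpow_mul, zpow_ofNat, zpow_ofNat]
  exact mul_mem (zpow_mem (sq_mem_squares h.left_mem) _)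
    (zpow_mem (sq_mem_squares h.right_mem) _)

theorem exists_eq_zpowers_of_le_zpowers {H : Subgroup G} {g : G} (h : H ≤ zpowers g) :
    ∃ u, H = zpowers u := by
  have hc : IsCyclic H := isCyclic_of_injective (inclusion h) (inclusion_injective h)
  obtain ⟨u, hu⟩ := H.isCyclic_iff_exists_zpowers_eq_top.1 hc
  exact ⟨u, hu.symm⟩

theorem exists_eq_closure_pair_of_le_zpowers {H : Subgroup G} {g : G} (h : H ≤ zpowers g) :
    ∃ u v, H = closure {u, v} := by
  obtain ⟨u, hu⟩ := exists_eq_zpowers_of_le_zpowers h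
  exact ⟨u, u, by rw [hu, zpowers_eq_closure, Set.pair_eq_singleton]⟩

/-- If `H` is contained neither in `K.squares` nor above `K`, then adjoining one element to a
generating set of `H ⊓ K.squares` generates `H`. -/
theorem eq_closure_insert_of_inf_squares_eq [Finite G] (hG : IsPGroup 2 G) {H K : Subgroup G}
    {u v h : G} {S : Set G} (hK : K = closure {u, v}) (hHK : H ≤ K) (hne : ¬ K ≤ H) (hh : h ∈ H)
    (hhs : h ∉ K.squares) (hS : H ⊓ K.squares = closure S) : H = closure (insert h S) := by
  have hSle : H ⊓ K.squares ≤ closure (insert h S) :=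
    hS.le.trans (closure_mono (Set.subset_insert h S))
  have hhc : h ∈ closure (insert h S) := subset_closure (Set.mem_insert h S)
  refine le_antisymm (fun g hg => ?_) ?_
  · rcases mem_squares_or_inv_mul_mem hG hK hHK hne hh hhs hg with h1 | h1
    · exact hSle ⟨hg, h1⟩
    · simpa using mul_mem hhc (hSle ⟨H.mul_mem (H.inv_mem hh) hg, h1⟩)
  · rw [closure_le]
    refine Set.insert_subset hh (subset_closure.trans ?_)
    rw [← hS]
    exact inf_le_left (a := H)

/-- Every subgroup of the subgroup generated by the squares of a bicyclic `2`-group is generated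
by two elements. -/
theorem IsZPowersMul.exists_eq_closure_pair_of_le_squares [Finite G] (hG : IsPGroup 2 G)
    {P : Subgroup G} {x y : G} (h : P.IsZPowersMul x y) {H : Subgroup G} (hH : H ≤ P.squares) :
    ∃ u v, H = closure {u, v} := by
  induction hn : Nat.card P using Nat.strong_induction_on generalizing P x y H with
  | _ n ih =>
  by_cases hP : ∃ g, P = zpowers g
  · obtain ⟨g, hg⟩ := hP
    exact exists_eq_closure_pair_of_le_zpowers (hH.trans (P.squares_le.trans hg.le))
  by_cases hK : ∃ g, P.squares = zpowers g
  · obtain ⟨g, hg⟩ := hK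
    exact exists_eq_closure_pair_of_le_zpowers (hH.trans hg.le)
  push Not at hP hK
  have hKbi := h.squares hG hP
  by_cases hKH : P.squares ≤ H
  · exact ⟨_, _, (le_antisymm hH hKH).trans hKbi.eq_closure⟩
  have hlt : Nat.card P.squares < n := by
    rw [← hn]
    refine lt_of_le_of_ne (card_le_of_le P.squares_le) fun he => ?_
    have := eq_of_le_of_card_ge P.squares_le he.ge
    exact notMem_squares_left hG h.eq_closure hP (this.ge h.left_mem)
  by_cases hHL : H ≤ P.squares.squares
  · exact ih _ hlt hKbi hHL rfl
  obtain ⟨t, htH, htL⟩ := SetLike.not_le_iff_exists.1 hHL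
  by_cases hL : ∃ g, P.squares.squares = zpowers g
  · obtain ⟨g, hg⟩ := hL
    obtain ⟨w, hw⟩ := exists_eq_zpowers_of_le_zpowers
      ((inf_le_right : H ⊓ P.squares.squares ≤ _).trans hg.le)
    rw [zpowers_eq_closure] at hw
    exact ⟨_, _, eq_closure_insert_of_inf_squares_eq hG hKbi.eq_closure hH hKH htH htL hw⟩
  push Not at hL
  obtain ⟨u, v, huv⟩ := ih _ hlt hKbi (inf_le_right : H ⊓ P.squares.squares ≤ _) rfl
  have ht2 := hKbi.sq_notMem_squares_squares hG hK hL
    (h.commutator_mem_squares hG hP hK hL) (hH htH) htL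
  obtain ⟨w, hw⟩ := exists_closure_pair_of_notMem_squares hG huv
    ⟨pow_mem htH 2, sq_mem_squares (hH htH)⟩ (fun hc => ht2 (squares_mono inf_le_right hc))
  have hHc := eq_closure_insert_of_inf_squares_eq hG hKbi.eq_closure hH hKH htH htL hw
  refine ⟨t, w, hHc.trans (le_antisymm ?_ (closure_mono (by grind)))⟩
  have ht : t ∈ closure {t, w} := subset_closure (by simp)
  have hwm : w ∈ closure {t, w} := subset_closure (by simp)
  rw [closure_le]
  rintro _ (rfl | rfl | rfl)
  exacts [ht, pow_mem ht 2, hwm]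

/-- Every subgroup of a bicyclic `2`-group is generated by three elements. -/
theorem IsZPowersMul.exists_eq_closure_triple [Finite G] (hG : IsPGroup 2 G)
    {P : Subgroup G} {x y : G} (h : P.IsZPowersMul x y) {H : Subgroup G} (hH : H ≤ P) :
    ∃ u v w, H = closure {u, v, w} := by
  suffices (∃ u v, H = closure {u, v}) ∨ ∃ u v w, H = closure {u, v, w} by
    rcases this with ⟨u, v, rfl⟩ | h
    · exact ⟨u, u, v, by simp⟩
    · exact h
  by_cases hPH : P ≤ H
  · exact Or.inl ⟨_, _, (le_antisymm hH hPH).trans h.eq_closure⟩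
  by_cases hHK : H ≤ P.squares
  · exact Or.inl (h.exists_eq_closure_pair_of_le_squares hG hHK)
  obtain ⟨t, htH, htK⟩ := SetLike.not_le_iff_exists.1 hHK
  obtain ⟨u, v, huv⟩ := h.exists_eq_closure_pair_of_le_squares hG
    (inf_le_right : H ⊓ P.squares ≤ _)
  exact Or.inr ⟨_, _, _, eq_closure_insert_of_inf_squares_eq hG h.eq_closure hH hPH htH htK huv⟩

end Subgroup

/-- Every section of a finite bicyclic `2`-group is generated by at most `3`
elements. -/
theorem section_of_bicyclic_rank_le_three (P : Type*) [Group P] [Finite P]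
    (hP2 : IsPGroup 2 P) (hbi : IsBicyclic P)
    (H : Subgroup P) (N : Subgroup H) [N.Normal] :
    ∃ S : Finset (H ⧸ N), S.card ≤ 3 ∧
      Subgroup.closure (S : Set (H ⧸ N)) = ⊤ := by
  classical
  obtain ⟨x, y, hxy⟩ := hbi
  have hbi : (⊤ : Subgroup P).IsZPowersMul x y :=
    ⟨Subgroup.mem_top x, Subgroup.mem_top y, fun g _ => hxy g⟩
  obtain ⟨u, v, w, rfl⟩ := hbi.exists_eq_closure_triple hP2 (le_top : H ≤ ⊤)
  have hm : ∀ g ∈ ({u, v, w} : Set P), g ∈ Subgroup.closure {u, v, w} :=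
    fun g hg => Subgroup.subset_closure hg
  let q := QuotientGroup.mk' N
  refine ⟨{q ⟨u, hm u (by simp)⟩, q ⟨v, hm v (by simp)⟩, q ⟨w, hm w (by simp)⟩},
    Finset.card_le_three, ?_⟩
  have htop := Subgroup.closure_closure_coe_preimage (k := ({u, v, w} : Set P))
  have hmap := congrArg (Subgroup.map q) htop
  rw [MonoidHom.map_closure, Subgroup.map_top_of_surjective q (QuotientGroup.mk'_surjective N)]
    at hmap
  rw [eq_top_iff, ← hmap, Subgroup.closure_le]
  rintro _ ⟨⟨g, hg⟩, hg', rfl⟩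
  apply Subgroup.subset_closure
  rcases hg' with h | h | h
  · rw [show (⟨g, hg⟩ : Subgroup.closure {u, v, w}) = ⟨u, hm u (by simp)⟩ from Subtype.ext h]
    simp
  · rw [show (⟨g, hg⟩ : Subgroup.closure {u, v, w}) = ⟨v, hm v (by simp)⟩ from Subtype.ext h]
    simp
  · rw [show (⟨g, hg⟩ : Subgroup.closure {u, v, w}) = ⟨w, hm w (by simp)⟩ from Subtype.ext h]
    simp
end

section
/- Let P be a finite bicyclic 2-group. Then every subgroup H of P contains a metacyclic subgroup of index at most 2; that is, there exists a subgroup M ≤ H such that M is metacyclic and the index of M in H is at most 2. -/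
/-- A group is metacyclic if it has a cyclic normal subgroup with cyclic quotient. -/
def IsMetacyclic (P : Type*) [Group P] : Prop :=
  ∃ (N : Subgroup P) (_ : N.Normal), IsCyclic N ∧ IsCyclic (P ⧸ N)

theorem IsMetacyclic.of_injective {A B : Type*} [Group A] [Group B] (f : A →* B)
    (hf : Function.Injective f) (hB : IsMetacyclic B) : IsMetacyclic A := by
  obtain ⟨N, hN, hc, hq⟩ := hB
  refine ⟨N.comap f, inferInstance, ?_, ?_⟩
  · refine isCyclic_of_injective
      ((f.comp (N.comap f).subtype).codRestrict N fun a => a.2) fun a b hab => ?_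
    exact Subtype.ext (hf (congrArg Subtype.val hab))
  · refine isCyclic_of_injective (QuotientGroup.map (N.comap f) N f le_rfl) ?_
    rw [injective_iff_map_eq_one]
    intro a
    induction a using QuotientGroup.induction_on with
    | H a =>
      intro h
      rw [QuotientGroup.map_mk, QuotientGroup.eq_one_iff] at h
      exact (QuotientGroup.eq_one_iff a).2 h

/-- A subgroup mapped into itself by conjugation by two generators of a finite group is normal. -/
theorem Subgroup.normal_of_conj_mem_of_closure_pair {G : Type*} [Group G] [Finite G]
    {N : Subgroup G} {k g : G} (hgen : Subgroup.closure {k, g} = ⊤)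
    (hk : ∀ n ∈ N, k * n * k⁻¹ ∈ N) (hg : ∀ n ∈ N, g * n * g⁻¹ ∈ N) : N.Normal := by
  rw [← Subgroup.normalizer_eq_top_iff, eq_top_iff, ← hgen, Subgroup.closure_le]
  rintro a (rfl | rfl)
  · exact Subgroup.mem_normalizer_fintype hk
  · exact Subgroup.mem_normalizer_fintype hg

theorem conj_zpow_mem_zpowers {G : Type*} [Group G] {k g : G}
    (h : g * k * g⁻¹ ∈ Subgroup.zpowers k) :
    ∀ n ∈ Subgroup.zpowers k, g * n * g⁻¹ ∈ Subgroup.zpowers k := by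
  rintro _ ⟨i, rfl⟩
  simpa only [conj_zpow] using Subgroup.zpow_mem _ h i

theorem isMetacyclic_of_closure_pair {G : Type*} [Group G] [Finite G] {k g : G}
    (hgen : Subgroup.closure {k, g} = ⊤) (h : g * k * g⁻¹ ∈ Subgroup.zpowers k) :
    IsMetacyclic G := by
  have hN : (Subgroup.zpowers k).Normal := by
    refine Subgroup.normal_of_conj_mem_of_closure_pair hgen ?_ (conj_zpow_mem_zpowers h)
    exact conj_zpow_mem_zpowers (by simp)
  refine ⟨Subgroup.zpowers k, hN, inferInstance, QuotientGroup.mk g, fun q => ?_⟩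
  induction q using QuotientGroup.induction_on with
  | H a =>
    have : (⊤ : Subgroup G) ≤ (Subgroup.zpowers (g : G ⧸ Subgroup.zpowers k)).comap
        (QuotientGroup.mk' _) := by
      rw [← hgen, Subgroup.closure_le]
      rintro a (rfl | rfl)
      · have : ((a : G) : G ⧸ Subgroup.zpowers a) = 1 :=
          (QuotientGroup.eq_one_iff a).2 (Subgroup.mem_zpowers a)
        simp [this]
      · simp
    exact this (Subgroup.mem_top a)

theorem IsMetacyclic.exists_closure_pair {G : Type*} [Group G] (h : IsMetacyclic G) :
    ∃ k g : G, Subgroup.closure {k, g} = ⊤ ∧ g * k * g⁻¹ ∈ Subgroup.zpowers k := by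
  obtain ⟨N, hN, hc, hq⟩ := h
  obtain ⟨k, hk⟩ := (Subgroup.isCyclic_iff_exists_zpowers_eq_top N).1 hc
  obtain ⟨q, hq⟩ := hq.exists_generator
  obtain ⟨g, rfl⟩ := QuotientGroup.mk_surjective q
  subst hk
  refine ⟨k, g, ?_, hN.conj_mem _ (Subgroup.mem_zpowers k) g⟩
  rw [eq_top_iff]
  intro a _
  obtain ⟨i, hi⟩ := hq a
  have hi : ((g ^ i : G) : G ⧸ Subgroup.zpowers k) = a := by simpa using hi
  rw [QuotientGroup.eq] at hi
  obtain ⟨j, hj⟩ := hi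
  have : a = g ^ i * k ^ j := by simp only at hj; rw [hj]; group
  rw [this]
  exact mul_mem (zpow_mem (Subgroup.subset_closure (by simp)) _)
    (zpow_mem (Subgroup.subset_closure (by simp)) _)

theorem IsPGroup.exists_index_two_ge {G : Type*} [Group G] [Finite G] (hG : IsPGroup 2 G)
    {H : Subgroup G} (hH : H ≠ ⊤) : ∃ K : Subgroup G, H ≤ K ∧ K.index = 2 := by
  obtain ⟨n, hn⟩ := IsPGroup.iff_card.1 hG
  obtain ⟨m, hm⟩ := IsPGroup.iff_card.1 (hG.to_subgroup H)
  have hlt : m < n := by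
    have := (Subgroup.card_le_card_group H).lt_of_ne fun h => hH (Subgroup.eq_top_of_card_eq H h)
    rw [hn, hm] at this
    exact (Nat.pow_lt_pow_iff_right (by norm_num)).1 this
  obtain ⟨K, hK, hHK⟩ := Sylow.exists_subgroup_card_pow_prime_le 2 (m := n - 1)
    (hn ▸ pow_dvd_pow 2 (Nat.sub_le n 1)) H hm (by omega)
  refine ⟨K, hHK, ?_⟩
  have := K.card_mul_index
  rw [hK, hn, show n = n - 1 + 1 by omega, pow_succ, Nat.add_sub_cancel] at this
  exact Nat.eq_of_mul_eq_mul_left (by positivity) this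

theorem IsPGroup.zpowers_zpow_of_odd {G : Type*} [Group G] (hG : IsPGroup 2 G) (x : G) {i : ℤ}
    (hi : Odd i) : Subgroup.zpowers (x ^ i) = Subgroup.zpowers x := by
  refine le_antisymm (Subgroup.zpowers_le.2 ⟨i, rfl⟩) (Subgroup.zpowers_le.2 ?_)
  obtain ⟨k, hk⟩ := hG x
  have hc : IsCoprime i (2 ^ k : ℤ) := (IsCoprime.symm
    (Int.prime_two.coprime_iff_not_dvd.2
      (by rwa [← even_iff_two_dvd, Int.not_even_iff_odd]))).pow_right
  obtain ⟨a, b, hab⟩ := hc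
  refine ⟨a, ?_⟩
  have hk' : x ^ ((2 : ℤ) ^ k) = 1 := by exact_mod_cast hk
  calc (x ^ i) ^ a = x ^ (a * i + b * 2 ^ k) := by
        rw [zpow_add, mul_comm b, zpow_mul x (2 ^ k), hk', one_zpow, mul_one, mul_comm, zpow_mul]
    _ = x := by rw [hab, zpow_one]

theorem IsPGroup.exists_central_involution {G : Type*} [Group G] [Finite G] (hG : IsPGroup 2 G)
    {N : Subgroup G} [N.Normal] (hN : N ≠ ⊥) :
    ∃ z ∈ N, z ∈ Subgroup.center G ∧ z ≠ 1 ∧ z ^ 2 = 1 := by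
  have hG' : IsPGroup 2 (ConjAct G) := hG
  have := Subgroup.nontrivial_iff_ne_bot N |>.2 hN
  have hdvd : 2 ∣ Nat.card N :=
    (hG.to_subgroup N).card_eq_or_dvd.resolve_left Finite.one_lt_card.ne'
  obtain ⟨b, hb, hb1⟩ := hG'.exists_fixed_point_of_prime_dvd_card_of_fixed_point N hdvd
    (a := 1) (fun g => smul_one g)
  have hbc : (b : G) ∈ Subgroup.center G := by
    rw [Subgroup.mem_center_iff]
    intro g
    have := congrArg Subtype.val (hb (ConjAct.toConjAct g))
    rw [ConjAct.Subgroup.val_conj_smul, ConjAct.toConjAct_smul] at this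
    exact mul_inv_eq_iff_eq_mul.1 this
  have hb1' : (b : G) ≠ 1 := fun h => hb1 (Subtype.ext h.symm)
  have h2 : 2 ∣ orderOf (b : G) := hG.dvd_orderOf hb1'
  have hpos := orderOf_pos (b : G)
  refine ⟨(b : G) ^ (orderOf (b : G) / 2), pow_mem b.2 _, pow_mem hbc _, ?_, ?_⟩
  · exact pow_ne_one_of_lt_orderOf (by omega) (by omega)
  · rw [← pow_mul, Nat.div_mul_cancel h2, pow_orderOf_eq_one]

theorem zpow_mul_zpow_of_mul_eq {G : Type*} [Group G] {x y z : G} (hz : z ∈ Subgroup.center G)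
    (hyx : y * x = x * y * z) (i j : ℤ) : y ^ j * x ^ i = x ^ i * y ^ j * z ^ (i * j) := by
  have hc : ∀ g, Commute g z := fun g => Subgroup.mem_center_iff.1 hz g
  have h1 : y * x ^ i * y⁻¹ = x ^ i * z ^ i := by
    rw [← conj_zpow, hyx, mul_assoc x, ← (hc x).mul_zpow, (hc y).eq]
    group
  have h2 : (x ^ i)⁻¹ * y * x ^ i = y * z ^ i := by
    rw [mul_inv_eq_iff_eq_mul] at h1
    rw [mul_assoc, h1, mul_assoc, ← ((hc y).zpow_right i).eq]
    group
  have h3 : (x ^ i)⁻¹ * y ^ j * x ^ i = y ^ j * z ^ (i * j) := by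
    rw [zpow_mul, ← ((hc y).zpow_right i).mul_zpow, ← h2]
    simpa using (conj_zpow (i := j) (a := (x ^ i)⁻¹) (b := y)).symm
  rw [mul_assoc (x ^ i), ← h3]
  group

theorem exists_zpow_mul_zpow_of_mem_closure_pair {G : Type*} [Group G] {a b m : G}
    (hab : Commute a b) (hm : m ∈ Subgroup.closure {a, b}) : ∃ i j : ℤ, m = a ^ i * b ^ j := by
  induction hm using Subgroup.closure_induction with
  | mem g hg =>
    rcases hg with rfl | rfl
    · exact ⟨1, 0, by simp⟩
    · exact ⟨0, 1, by simp⟩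
  | one => exact ⟨0, 0, by simp⟩
  | mul g h _ _ hg hh =>
    obtain ⟨i, j, rfl⟩ := hg
    obtain ⟨k, l, rfl⟩ := hh
    refine ⟨i + k, j + l, ?_⟩
    rw [zpow_add, zpow_add, mul_assoc, mul_assoc, ← mul_assoc (b ^ j),
      ((hab.zpow_zpow k j).symm).eq, mul_assoc]
  | inv g _ hg =>
    obtain ⟨i, j, rfl⟩ := hg
    exact ⟨-i, -j, by rw [mul_inv_rev, zpow_neg, zpow_neg, ((hab.zpow_zpow i j).inv_inv).eq]⟩

/-- Three integer vectors of length two are linearly dependent modulo two. -/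
theorem exists_even_combination (p q : Fin 3 → ℤ) :
    ∃ c : Fin 3 → ℕ, (∀ t, c t < 2) ∧ c ≠ 0 ∧
      Even (c 0 * p 0 + c 1 * p 1 + c 2 * p 2) ∧ Even (c 0 * q 0 + c 1 * q 1 + c 2 * q 2) := by
  have key : ∀ p₀ p₁ p₂ q₀ q₁ q₂ : ZMod 2, ∃ c₀ c₁ c₂ : ZMod 2, ¬(c₀ = 0 ∧ c₁ = 0 ∧ c₂ = 0) ∧
      c₀ * p₀ + c₁ * p₁ + c₂ * p₂ = 0 ∧ c₀ * q₀ + c₁ * q₁ + c₂ * q₂ = 0 := by decide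
  obtain ⟨c₀, c₁, c₂, h, hp, hq⟩ := key (p 0) (p 1) (p 2) (q 0) (q 1) (q 2)
  refine ⟨![c₀.val, c₁.val, c₂.val], fun t => ?_, fun h0 => h ?_, ?_, ?_⟩
  · fin_cases t
    exacts [ZMod.val_lt c₀, ZMod.val_lt c₁, ZMod.val_lt c₂]
  · have h0' := congrFun h0
    exact ⟨(ZMod.val_eq_zero _).1 (h0' 0), (ZMod.val_eq_zero _).1 (h0' 1),
      (ZMod.val_eq_zero _).1 (h0' 2)⟩
  all_goals
    rw [even_iff_two_dvd, ← Nat.cast_two, ← ZMod.intCast_zmod_eq_zero_iff_dvd]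
    simpa

theorem zpow_mem_iff_even_of_index_two {G : Type*} [Group G] {M : Subgroup G} (hM : M.index = 2)
    {x : G} (hx : x ∉ M) (i : ℤ) : x ^ i ∈ M ↔ Even i := by
  have hsq : ∀ j : ℤ, x ^ (2 * j) ∈ M := fun j => by
    rw [zpow_mul, zpow_ofNat]
    exact zpow_mem (Subgroup.sq_mem_of_index_two hM x) j
  rcases Int.even_or_odd' i with ⟨j, rfl | rfl⟩
  · simp [hsq]
  · simp [zpow_add_one, Subgroup.mul_mem_cancel_left _ (hsq j), hx]

theorem mem_zpowers_of_eq_sq_mul_sq {G : Type*} [Group G] (hG : IsPGroup 2 G)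
    {x y z : G} (hbi : ∀ g : G, ∃ i j : ℤ, g = x ^ i * y ^ j) (hz : z ∈ Subgroup.center G)
    (hz1 : z ≠ 1) (hz2 : z ^ 2 = 1) (hyx : y * x = x * y * z) (hxy : z = x ^ 2 * y ^ 2)
    {M : Subgroup G} (hM : M.index = 2) (hx : x ∉ M) (hy : y ∉ M) {a b : G}
    (hab : M = Subgroup.closure {a, b}) :
    z ∈ Subgroup.zpowers x ∨ z ∈ Subgroup.zpowers y := by
  by_contra! hnot
  obtain ⟨hnx, hny⟩ := hnot
  have hc : ∀ g, Commute g z := fun g => Subgroup.mem_center_iff.1 hz g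
  have hux : x * y * x = x * (x * y) * z := by rw [mul_assoc, hyx]; group
  have hu2 : (x * y) ^ 2 = 1 := by
    calc (x * y) ^ 2 = x * (y * x) * y := by rw [pow_two]; group
      _ = x * x * y * (z * y) := by rw [hyx]; group
      _ = x ^ 2 * y ^ 2 * z := by rw [← (hc y).eq]; simp only [pow_two, mul_assoc]
      _ = 1 := by rw [← hxy, ← pow_two, hz2]
  set u := x * y with hu
  have huX : Commute u (x ^ 2) := by
    have := zpow_mul_zpow_of_mul_eq hz hux 2 1
    simp only [mul_one, zpow_one] at this
    rw [show z ^ (2 : ℤ) = 1 by exact_mod_cast hz2, mul_one] at this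
    exact_mod_cast this
  have hy2 : y ^ 2 = (x ^ 2)⁻¹ * z := by rw [hxy]; group
  have hform : ∀ m ∈ M, ∃ (e : ℕ) (t s : ℤ), m = u ^ e * (x ^ 2) ^ t * z ^ s := by
    intro m hm
    obtain ⟨r, s, rfl⟩ := hbi m
    have hyp : ∀ s : ℤ, y ^ (2 * s) = (x ^ 2) ^ (-s) * z ^ s := by
      intro s
      rw [zpow_mul, zpow_ofNat, hy2, (hc _).mul_zpow, inv_zpow, zpow_neg]
    have hxp : ∀ r : ℤ, x ^ (2 * r) = (x ^ 2) ^ r := fun r => by rw [zpow_mul, zpow_ofNat]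
    rw [Subgroup.mul_mem_iff_of_index_two hM, zpow_mem_iff_even_of_index_two hM hx,
      zpow_mem_iff_even_of_index_two hM hy] at hm
    rcases Int.even_or_odd' s with ⟨s', rfl | rfl⟩
    · obtain ⟨r', rfl⟩ := even_iff_two_dvd.1 (hm.2 (even_two_mul s'))
      exact ⟨0, r' + -s', s', by rw [hxp, hyp, zpow_add, pow_zero, one_mul, mul_assoc]⟩
    · obtain ⟨r', rfl⟩ := Int.not_even_iff_odd.1
        (mt hm.1 (Int.not_even_iff_odd.2 (odd_two_mul_add_one s')))
      refine ⟨1, r' + -s', s', ?_⟩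
      calc x ^ (2 * r' + 1) * y ^ (2 * s' + 1) = x ^ (2 * r') * u * y ^ (2 * s') := by
            rw [zpow_add_one, add_comm (2 * s'), zpow_one_add, hu]; group
        _ = u ^ 1 * (x ^ 2) ^ (r' + -s') * z ^ s' := by
            rw [hxp, hyp, ← (huX.zpow_right r').eq, zpow_add, pow_one]; simp only [mul_assoc]
  have hcomm : ∀ m ∈ M, ∀ n ∈ M, Commute m n := by
    intro m hm n hn
    obtain ⟨e, t, s, rfl⟩ := hform m hm
    obtain ⟨e', t', s', rfl⟩ := hform n hn
    have h1 : Commute (u ^ e * (x ^ 2) ^ t) (u ^ e' * (x ^ 2) ^ t') :=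
      Commute.mul_left (((Commute.refl u).pow_pow e e').mul_right (huX.pow_left e |>.zpow_right t'))
        (((huX.symm.pow_right e').zpow_left t).mul_right ((Commute.refl _).zpow_zpow t t'))
    exact ((h1.mul_right ((hc _).zpow_right s')).mul_left
      (((hc _).symm.zpow_left s)))
  have hsq : ∀ m ∈ M, ∃ t : ℤ, m ^ 2 = (x ^ 2) ^ (2 * t) := by
    intro m hm
    obtain ⟨e, t, s, rfl⟩ := hform m hm
    refine ⟨t, ?_⟩
    rw [((hc _).zpow_right s).mul_pow, (huX.pow_left e |>.zpow_right t).mul_pow, ← pow_mul,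
      mul_comm e, pow_mul, hu2, one_pow, one_mul]
    have : (z ^ s) ^ 2 = 1 := by
      rw [← zpow_natCast, ← zpow_mul, mul_comm, zpow_mul, zpow_natCast, hz2, one_zpow]
    rw [this, mul_one, mul_comm 2 t, zpow_mul, zpow_ofNat]
  have ha : a ∈ M := hab ▸ Subgroup.subset_closure (by simp)
  have hb : b ∈ M := hab ▸ Subgroup.subset_closure (by simp)
  have hcab := hcomm a ha b hb
  obtain ⟨ta, hta⟩ := hsq a ha
  obtain ⟨tb, htb⟩ := hsq b hb
  have hXM : x ^ 2 ∈ M := Subgroup.sq_mem_of_index_two hM x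
  have hzM : z ∈ M := hxy ▸ mul_mem hXM (Subgroup.sq_mem_of_index_two hM y)
  have huM : u ∈ M := (Subgroup.mul_mem_iff_of_index_two hM).2 (by simp [hx, hy])
  rw [hab] at hXM hzM huM
  obtain ⟨i₀, j₀, h₀⟩ := exists_zpow_mul_zpow_of_mem_closure_pair hcab huM
  obtain ⟨i₁, j₁, h₁⟩ := exists_zpow_mul_zpow_of_mem_closure_pair hcab hXM
  obtain ⟨i₂, j₂, h₂⟩ := exists_zpow_mul_zpow_of_mem_closure_pair hcab hzM
  obtain ⟨c, hc2, hc0, ⟨p, hp⟩, ⟨q, hq⟩⟩ := exists_even_combination ![i₀, i₁, i₂] ![j₀, j₁, j₂]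
  have hpow : ∀ (i j : ℤ) (n : ℕ), (a ^ i * b ^ j) ^ n = a ^ (n * i) * b ^ (n * j) := by
    intro i j n
    rw [(hcab.zpow_zpow i j).mul_pow, ← zpow_natCast, ← zpow_natCast, ← zpow_mul, ← zpow_mul,
      mul_comm i, mul_comm j]
  have hmul : ∀ i j k l : ℤ, a ^ i * b ^ j * (a ^ k * b ^ l) = a ^ (i + k) * b ^ (j + l) := by
    intro i j k l
    rw [zpow_add, zpow_add, mul_assoc, ← mul_assoc (b ^ j), ((hcab.zpow_zpow k j).symm).eq]
    simp only [mul_assoc]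
  have hdep : u ^ c 0 * (x ^ 2) ^ c 1 * z ^ c 2 = (x ^ 2) ^ (2 * (ta * p + tb * q)) := by
    rw [h₀, h₂]
    nth_rw 1 [h₁]
    rw [hpow, hpow, hpow, hmul, hmul]
    simp only [Matrix.cons_val_zero, Matrix.cons_val_one, Matrix.cons_val] at hp hq
    rw [hp, hq, ← two_mul, ← two_mul, zpow_mul a, zpow_mul b]
    rw [zpow_ofNat a 2, zpow_ofNat b 2, hta, htb,
      ← zpow_mul, ← zpow_mul, ← zpow_add]
    ring_nf
  generalize ta * p + tb * q = n at hdep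
  have e0 := hc2 0
  have e1 := hc2 1
  have e2 := hc2 2
  have hx2 : Commute (x ^ 2) x := (Commute.refl x).pow_left 2
  have c0 : c 0 = 0 := by
    by_contra h
    have h1 : c 0 = 1 := by omega
    rw [h1, pow_one] at hdep
    have hux' : Commute u x := by
      have : u = (x ^ 2) ^ (2 * n) * ((x ^ 2) ^ c 1 * z ^ c 2)⁻¹ := by rw [← hdep]; group
      rw [this]
      exact (hx2.zpow_left _).mul_left
        (((hx2.pow_left _).mul_left ((hc x).symm.pow_left _)).inv_left)
    rw [hux'.eq] at hux
    exact hz1 (by simpa using hux)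
  rw [c0, pow_zero, one_mul] at hdep
  have c2 : c 2 = 0 := by
    by_contra h
    have h1 : c 2 = 1 := by omega
    rw [h1, pow_one] at hdep
    refine hnx ?_
    have hX : x ^ 2 ∈ Subgroup.zpowers x := pow_mem (Subgroup.mem_zpowers x) 2
    exact (Subgroup.mul_mem_cancel_left _ (pow_mem hX (c 1))).1 (hdep ▸ zpow_mem hX _)
  have c1 : c 1 = 1 := by
    by_contra h
    refine hc0 (funext fun t => ?_)
    fin_cases t
    · exact c0
    · change c 1 = 0; omega
    · exact c2
  rw [c1, c2, pow_one, pow_zero, mul_one] at hdep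
  have hX1 : (x ^ 2) ^ (2 * n - 1) = 1 := by rw [zpow_sub_one, ← hdep, mul_inv_cancel]
  have := hG.zpowers_zpow_of_odd (x ^ 2) (i := 2 * n - 1) ⟨n - 1, by ring⟩
  rw [hX1, Subgroup.zpowers_one_eq_bot, eq_comm, Subgroup.zpowers_eq_bot] at this
  refine hny ?_
  rw [hxy, this, one_mul]
  exact pow_mem (Subgroup.mem_zpowers y) 2

theorem closure_pair_eq_top_of_forall_eq {G : Type*} [Group G] {x y : G}
    (hbi : ∀ g : G, ∃ i j : ℤ, g = x ^ i * y ^ j) : Subgroup.closure {x, y} = ⊤ := by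
  rw [eq_top_iff]
  intro g _
  obtain ⟨i, j, rfl⟩ := hbi g
  exact mul_mem (zpow_mem (Subgroup.subset_closure (by simp)) _)
    (zpow_mem (Subgroup.subset_closure (by simp)) _)

theorem forall_eq_zpow_mul_zpow_swap {G : Type*} [Group G] {x y : G}
    (hbi : ∀ g : G, ∃ i j : ℤ, g = x ^ i * y ^ j) (g : G) : ∃ i j : ℤ, g = y ^ i * x ^ j := by
  obtain ⟨i, j, h⟩ := hbi g⁻¹
  exact ⟨-j, -i, by rw [← inv_inv g, h]; group⟩

theorem isMetacyclic_of_mul_eq_of_mem {G : Type*} [Group G] [Finite G] {k g z : G}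
    (hgen : Subgroup.closure {k, g} = ⊤) (hz : z ∈ Subgroup.center G)
    (hgk : g * k = k * g * z) (hmem : z ∈ Subgroup.zpowers k ∨ z ∈ Subgroup.zpowers g) :
    IsMetacyclic G := by
  have hc : ∀ g, Commute g z := fun g => Subgroup.mem_center_iff.1 hz g
  rcases hmem with h | h
  · refine isMetacyclic_of_closure_pair hgen ?_
    rw [hgk, mul_assoc k, (hc g).eq, mul_assoc, mul_inv_cancel_right]
    exact mul_mem (Subgroup.mem_zpowers k) h
  · refine isMetacyclic_of_closure_pair (k := g) (g := k) (by rwa [Set.pair_comm]) ?_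
    have : k * g * k⁻¹ = g * z⁻¹ := by
      rw [mul_inv_eq_iff_eq_mul, mul_assoc, ← ((hc k).inv_right).eq, ← mul_assoc, hgk]
      group
    rw [this]
    exact mul_mem (Subgroup.mem_zpowers g) (inv_mem h)

theorem isMetacyclic_of_eq_two_pow_of_le {G : Type*} [Group G] [Finite G] (hG : IsPGroup 2 G)
    {x y z : G} (hbi : ∀ g : G, ∃ i j : ℤ, g = x ^ i * y ^ j) (hz : z ∈ Subgroup.center G)
    (hz1 : z ≠ 1) (hz2 : z ^ 2 = 1) (hyx : y * x = x * y * z) {s t : ℕ} (hts : t ≤ s)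
    (hxy : z = x ^ 2 ^ (s + 1) * y ^ 2 ^ (t + 1))
    {M : Subgroup G} (hM : M.index = 2) (hx : x ∉ M) (hy : y ∉ M) {a b : G}
    (hab : M = Subgroup.closure {a, b}) : IsMetacyclic G := by
  have hc : ∀ g, Commute g z := fun g => Subgroup.mem_center_iff.1 hz g
  have hgen := closure_pair_eq_top_of_forall_eq hbi
  obtain ⟨d, rfl⟩ := Nat.exists_eq_add_of_le hts
  rcases Nat.eq_zero_or_pos (t + d) with h0 | hpos
  · obtain ⟨rfl, rfl⟩ : t = 0 ∧ d = 0 := by omega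
    exact isMetacyclic_of_mul_eq_of_mem hgen hz hyx
      (mem_zpowers_of_eq_sq_mul_sq hG hbi hz hz1 hz2 hyx (by simpa using hxy) hM hx hy hab)
  have hcomm : ∀ i j : ℕ, y ^ j * x ^ i = x ^ i * y ^ j * z ^ (i * j) := fun i j => by
    exact_mod_cast zpow_mul_zpow_of_mul_eq hz hyx i j
  refine isMetacyclic_of_mul_eq_of_mem (k := x) (g := x ^ 2 ^ d * y) ?_ hz ?_ (Or.inr ?_)
  · rw [eq_top_iff, ← hgen, Subgroup.closure_le]
    have hx' : x ∈ Subgroup.closure {x, x ^ 2 ^ d * y} := Subgroup.subset_closure (by simp)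
    rintro g (rfl | rfl)
    · exact hx'
    · exact (Subgroup.mul_mem_cancel_left _ (pow_mem hx' (2 ^ d))).1
        (Subgroup.subset_closure (by simp))
  · rw [mul_assoc, hyx, ← mul_assoc, ← mul_assoc, ← mul_assoc, (Commute.self_pow x (2 ^ d)).eq]
  · have hsq : (x ^ 2 ^ d * y) ^ 2 = x ^ (2 * 2 ^ d) * y ^ 2 * z ^ 2 ^ d := by
      have h := hcomm (2 ^ d) 1
      rw [pow_one, mul_one] at h
      calc (x ^ 2 ^ d * y) ^ 2 = x ^ 2 ^ d * (y * x ^ 2 ^ d) * y := by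
            rw [pow_two]; simp only [mul_assoc]
        _ = x ^ 2 ^ d * x ^ 2 ^ d * y * (z ^ 2 ^ d * y) := by rw [h]; simp only [mul_assoc]
        _ = _ := by
            rw [← ((hc y).pow_right (2 ^ d)).eq, ← pow_add, ← two_mul, pow_two]
            simp only [mul_assoc]
    have hxy2 : Commute (x ^ (2 * 2 ^ d)) (y ^ 2) := by
      have h := hcomm (2 * 2 ^ d) 2
      rw [mul_comm _ 2, pow_mul z, hz2, one_pow, mul_one] at h
      exact h.symm
    refine ⟨(2 ^ (t + 1) : ℕ), ?_⟩
    have hzd : (z ^ 2 ^ d) ^ 2 ^ t = 1 := by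
      rw [← pow_mul, ← pow_add, add_comm d, show t + d = (t + d - 1) + 1 by omega, pow_succ',
        pow_mul, hz2, one_pow]
    have : (x ^ 2 ^ d * y) ^ 2 ^ (t + 1) = z := by
      rw [pow_succ' 2 t, pow_mul, hsq, ((hc _).pow_right _).mul_pow, hzd, mul_one, hxy2.mul_pow,
        ← pow_mul, ← pow_mul, ← pow_succ', ← pow_succ', ← pow_add, add_right_comm, add_comm d t,
        ← hxy]
    simpa only [zpow_natCast] using this

theorem isMetacyclic_of_mul_eq {G : Type*} [Group G] [Finite G] (hG : IsPGroup 2 G)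
    {x y z : G} (hbi : ∀ g : G, ∃ i j : ℤ, g = x ^ i * y ^ j) (hz : z ∈ Subgroup.center G)
    (hz1 : z ≠ 1) (hz2 : z ^ 2 = 1) (hyx : y * x = x * y * z)
    {M : Subgroup G} (hM : M.index = 2) (hx : x ∉ M) (hy : y ∉ M) {a b : G}
    (hab : M = Subgroup.closure {a, b}) : IsMetacyclic G := by
  have hc : ∀ g, Commute g z := fun g => Subgroup.mem_center_iff.1 hz g
  have hzodd : ∀ i : ℤ, Odd i → z ^ i = z := by
    rintro _ ⟨i, rfl⟩
    rw [zpow_add_one, zpow_mul, zpow_ofNat, hz2, one_zpow, one_mul]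
  have hzeven : ∀ i : ℤ, z ^ i = 1 → Even i := fun i hi => by
    by_contra h
    exact hz1 ((hzodd i (Int.not_even_iff_odd.1 h)).symm.trans hi)
  obtain ⟨i, j, hij⟩ := hbi z
  have hie : Even i := by
    refine hzeven i ?_
    have h := zpow_mul_zpow_of_mul_eq hz hyx i 1
    have hxi : x ^ i = z * (y ^ j)⁻¹ := eq_mul_inv_of_mul_eq hij.symm
    have hcx : Commute y (x ^ i) := by
      rw [hxi]; exact (hc y).mul_right (((Commute.refl y).zpow_right j).inv_right)
    rw [mul_one, zpow_one, hcx.eq] at h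
    exact (mul_eq_left.1 h.symm)
  have hje : Even j := by
    refine hzeven j ?_
    have h := zpow_mul_zpow_of_mul_eq hz hyx 1 j
    have hyj : y ^ j = (x ^ i)⁻¹ * z := eq_inv_mul_of_mul_eq hij.symm
    have hcy : Commute x (y ^ j) := by
      rw [hyj]; exact (((Commute.refl x).zpow_right i).inv_right).mul_right (hc x)
    rw [one_mul, zpow_one, ← hcy.eq] at h
    exact (mul_eq_left.1 h.symm)
  have hgen := closure_pair_eq_top_of_forall_eq hbi
  rcases eq_or_ne i 0 with rfl | hi0
  · exact isMetacyclic_of_mul_eq_of_mem hgen hz hyx (Or.inr ⟨j, by simp [hij]⟩)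
  rcases eq_or_ne j 0 with rfl | hj0
  · exact isMetacyclic_of_mul_eq_of_mem hgen hz hyx (Or.inl ⟨i, by simp [hij]⟩)
  have hfac : ∀ n : ℤ, n ≠ 0 → Even n → ∃ (s : ℕ) (m : ℤ), Odd m ∧ n = m * (2 ^ (s + 1) : ℕ) := by
    intro n hn he
    obtain ⟨s, m, hm, h⟩ := Nat.exists_eq_two_pow_mul_odd (Int.natAbs_ne_zero.2 hn)
    have hs : s ≠ 0 := by
      rintro rfl
      rw [pow_zero, one_mul] at h
      rw [← Int.natAbs_even, h] at he
      exact Nat.not_even_iff_odd.2 hm he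
    obtain ⟨s, rfl⟩ := Nat.exists_eq_succ_of_ne_zero hs
    refine ⟨s, n.sign * m, ?_, ?_⟩
    · refine Odd.mul ?_ (by exact_mod_cast hm)
      rcases lt_or_gt_of_ne hn with h | h
      · rw [Int.sign_eq_neg_one_of_neg h]; decide
      · rw [Int.sign_eq_one_of_pos h]; decide
    · conv_lhs => rw [← Int.sign_mul_natAbs n, h]
      push_cast [Nat.succ_eq_add_one]; ring
  obtain ⟨s, m, hm, rfl⟩ := hfac i hi0 hie
  obtain ⟨t, n, hn, rfl⟩ := hfac j hj0 hje
  have hbi' : ∀ g : G, ∃ i j : ℤ, g = (x ^ m) ^ i * (y ^ n) ^ j := by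
    intro g
    obtain ⟨i, j, rfl⟩ := hbi g
    have h1 : x ^ i ∈ Subgroup.zpowers (x ^ m) := by
      rw [hG.zpowers_zpow_of_odd x hm]; exact ⟨i, rfl⟩
    have h2 : y ^ j ∈ Subgroup.zpowers (y ^ n) := by
      rw [hG.zpowers_zpow_of_odd y hn]; exact ⟨j, rfl⟩
    obtain ⟨k, hk⟩ := h1
    obtain ⟨l, hl⟩ := h2
    exact ⟨k, l, by simp only at hk hl; rw [hk, hl]⟩
  have hyx' : y ^ n * x ^ m = x ^ m * y ^ n * z := by
    rw [zpow_mul_zpow_of_mul_eq hz hyx, hzodd _ (hm.mul hn)]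
  have hx' : x ^ m ∉ M := by
    rwa [zpow_mem_iff_even_of_index_two hM hx, Int.not_even_iff_odd]
  have hy' : y ^ n ∉ M := by
    rwa [zpow_mem_iff_even_of_index_two hM hy, Int.not_even_iff_odd]
  have hz' : z = (x ^ m) ^ 2 ^ (s + 1) * (y ^ n) ^ 2 ^ (t + 1) := by
    rw [zpow_mul, zpow_mul, zpow_natCast, zpow_natCast] at hij
    exact hij
  rcases le_total t s with hts | hts
  · exact isMetacyclic_of_eq_two_pow_of_le hG hbi' hz hz1 hz2 hyx' hts hz' hM hx' hy' hab
  · refine isMetacyclic_of_eq_two_pow_of_le hG (forall_eq_zpow_mul_zpow_swap hbi') hz hz1 hz2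
      ?_ hts ?_ hM hy' hx' hab
    · rw [hyx', mul_assoc, ← pow_two, hz2, mul_one]
    · rw [eq_inv_mul_of_mul_eq hz'.symm, mul_assoc, ← (hc _).eq, inv_mul_cancel_left]

open scoped commutatorElement

/-- The commutator subgroup is contained in every normal subgroup modulo which two generators
commute. -/
theorem commutator_le_of_closure_pair {G : Type*} [Group G] {N : Subgroup G} [N.Normal] {k g : G}
    (hgen : Subgroup.closure {k, g} = ⊤) (h : (Commute (k : G ⧸ N) (g : G ⧸ N))) :
    commutator G ≤ N := by
  have key : ∀ a : G, ∃ i j : ℤ, (a : G ⧸ N) = (k : G ⧸ N) ^ i * (g : G ⧸ N) ^ j := by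
    intro a
    refine exists_zpow_mul_zpow_of_mem_closure_pair h ?_
    have ha : a ∈ Subgroup.closure {k, g} := hgen ▸ Subgroup.mem_top a
    have := Subgroup.mem_map_of_mem (QuotientGroup.mk' N) ha
    rwa [MonoidHom.map_closure, Set.image_pair] at this
  rw [commutator_def, Subgroup.commutator_le]
  intro a _ b _
  rw [← QuotientGroup.eq_one_iff, commutatorElement_def]
  obtain ⟨i, j, ha⟩ := key a
  obtain ⟨i', j', hb⟩ := key b
  have hcomm : Commute (a : G ⧸ N) (b : G ⧸ N) := by
    rw [ha, hb]
    exact (((Commute.refl _).zpow_zpow i i').mul_right (h.zpow_zpow i j')).mul_left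
      ((h.symm.zpow_zpow j i').mul_right ((Commute.refl _).zpow_zpow j j'))
  change (a : G ⧸ N) * b * (a : G ⧸ N)⁻¹ * (b : G ⧸ N)⁻¹ = 1
  rw [hcomm.eq]
  group

/-- A finite `2`-group `G` with an involution `z` in the centre and the derived subgroup such that
`G ⧸ ⟨z⟩` is metacyclic is itself metacyclic, unless its derived subgroup is `⟨z⟩`. -/
theorem isMetacyclic_or_commutator_le_of_quotient {G : Type*} [Group G] [Finite G]
    (hG : IsPGroup 2 G) {z : G} (hz : z ∈ Subgroup.center G) (hz2 : z ^ 2 = 1)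
    (hzG : z ∈ commutator G) [(Subgroup.zpowers z).Normal]
    (hQ : IsMetacyclic (G ⧸ Subgroup.zpowers z)) :
    IsMetacyclic G ∨ commutator G ≤ Subgroup.zpowers z := by
  have hc : ∀ g, Commute g z := fun g => Subgroup.mem_center_iff.1 hz g
  obtain ⟨k, g, hgenQ, hkg⟩ := hQ.exists_closure_pair
  obtain ⟨k, rfl⟩ := QuotientGroup.mk_surjective k
  obtain ⟨g, rfl⟩ := QuotientGroup.mk_surjective g
  have hgen : Subgroup.closure {k, g} = ⊤ := by
    set H := Subgroup.closure {k, g} with hH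
    have hdec : ∀ a : G, ∃ h ∈ H, ∃ i : ℤ, a = h * z ^ i := by
      intro a
      have ha : (a : G ⧸ Subgroup.zpowers z) ∈ H.map (QuotientGroup.mk' _) := by
        rw [hH, MonoidHom.map_closure, Set.image_pair]
        exact hgenQ ▸ Subgroup.mem_top _
      obtain ⟨h, hh, hha⟩ := ha
      obtain ⟨i, hi⟩ := QuotientGroup.eq.1 hha
      exact ⟨h, hh, i, by simp only at hi; rw [hi]; group⟩
    have hcomm : commutator G ≤ H := by
      rw [commutator_def, Subgroup.commutator_le]
      intro a _ b _
      obtain ⟨h, hh, i, rfl⟩ := hdec a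
      obtain ⟨h', hh', j, rfl⟩ := hdec b
      have : ⁅h * z ^ i, h' * z ^ j⁆ = ⁅h, h'⁆ := by
        calc ⁅h * z ^ i, h' * z ^ j⁆
            = h * (z ^ i * h') * z ^ j * (z ^ i)⁻¹ * (h⁻¹ * (z ^ j)⁻¹) * h'⁻¹ := by
              rw [commutatorElement_def]; group
          _ = _ := by
              rw [← ((hc h').zpow_right i).eq, ((hc h⁻¹).zpow_right j).inv_right.eq,
                commutatorElement_def]
              group
      rw [this, commutatorElement_def]
      exact mul_mem (mul_mem (mul_mem hh hh') (inv_mem hh)) (inv_mem hh')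
    rw [eq_top_iff]
    intro a _
    obtain ⟨h, hh, i, rfl⟩ := hdec a
    exact mul_mem hh (zpow_mem (hcomm hzG) i)
  obtain ⟨m, hm⟩ := hkg
  have hm : ((k ^ m : G) : G ⧸ Subgroup.zpowers z) = ((g * k * g⁻¹ : G) : _) := by
    simpa using hm
  obtain ⟨e, he⟩ := QuotientGroup.eq.1 hm
  have he : g * k * g⁻¹ = k ^ m * z ^ e := by simp only at he; rw [he]; group
  -- the derived subgroup is generated by the commutator of `k` and `g`
  set c := k ^ (m - 1) * z ^ e with hcdef
  have hkc : Commute k c := ((Commute.refl k).zpow_right _).mul_right ((hc k).zpow_right e)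
  have hgk : g * k * g⁻¹ = c * k := by
    rw [he, hkc.symm.eq, hcdef, ← mul_assoc, ← zpow_one_add, add_sub_cancel]
  have hgc : g * c * g⁻¹ = c ^ m := by
    have h1 : g * k ^ (m - 1) * g⁻¹ = (k ^ m * z ^ e) ^ (m - 1) := by rw [← he, conj_zpow]
    calc g * c * g⁻¹ = g * k ^ (m - 1) * g⁻¹ * z ^ e := by
          rw [hcdef, ← mul_assoc, mul_assoc _ (z ^ e), ← ((hc g⁻¹).zpow_right e).eq, mul_assoc]
          simp only [mul_assoc]
      _ = c ^ m := by
          rw [h1, ((hc _).zpow_right e).mul_zpow, hcdef, ((hc _).zpow_right e).mul_zpow,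
            mul_assoc, ← zpow_add_one, sub_add_cancel, ← zpow_mul, ← zpow_mul, ← zpow_mul,
            mul_comm m]
  have hCn : (Subgroup.zpowers c).Normal := by
    refine Subgroup.normal_of_conj_mem_of_closure_pair hgen ?_ ?_
    · exact conj_zpow_mem_zpowers (by simp [hkc.eq])
    · exact conj_zpow_mem_zpowers (hgc ▸ ⟨m, rfl⟩)
  have hle : commutator G ≤ Subgroup.zpowers c := by
    refine commutator_le_of_closure_pair hgen (Eq.symm ?_)
    have : ((g * k * g⁻¹ : G) : G ⧸ Subgroup.zpowers c) = k := by
      rw [hgk, QuotientGroup.mk_mul, (QuotientGroup.eq_one_iff c).2 (Subgroup.mem_zpowers c),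
        one_mul]
    exact mul_inv_eq_iff_eq_mul.1 this
  obtain ⟨j, hj⟩ := hle hzG
  have hj : z = k ^ ((m - 1) * j) * z ^ (e * j) := by
    simp only at hj
    rw [zpow_mul, zpow_mul, ← ((hc _).zpow_right e).mul_zpow, hj]
  have hmeta : z ∈ Subgroup.zpowers k → IsMetacyclic G := fun h =>
    isMetacyclic_of_closure_pair hgen (he ▸ mul_mem ⟨m, rfl⟩ (zpow_mem h e))
  have hz2' : z ^ (2 : ℤ) = 1 := by exact_mod_cast hz2
  rcases Int.even_or_odd' (e * j) with ⟨t, ht | ht⟩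
  · left
    rw [ht, zpow_mul z, hz2', one_zpow, mul_one] at hj
    exact hmeta ⟨_, hj.symm⟩
  · rw [ht, zpow_add_one, zpow_mul z, hz2', one_zpow, one_mul, right_eq_mul, zpow_mul] at hj
    have hodd : Odd j := (Int.odd_mul.1 ⟨t, ht⟩).2
    have h1 := hG.zpowers_zpow_of_odd (k ^ (m - 1)) hodd
    rw [hj, Subgroup.zpowers_one_eq_bot, eq_comm, Subgroup.zpowers_eq_bot] at h1
    right
    refine hle.trans (Subgroup.zpowers_le.2 ?_)
    rw [hcdef, h1, one_mul]
    exact ⟨e, rfl⟩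

/-- A finite bicyclic `2`-group `⟨x⟩⟨y⟩` is metacyclic as soon as its maximal subgroup containing
neither `x` nor `y` is generated by two elements. -/
theorem isMetacyclic_of_index_two_closure_pair {G : Type*} [Group G] [Finite G]
    (hG : IsPGroup 2 G) {x y : G} (hbi : ∀ g : G, ∃ i j : ℤ, g = x ^ i * y ^ j)
    {M : Subgroup G} (hM : M.index = 2) (hx : x ∉ M) (hy : y ∉ M) {a b : G}
    (hab : M = Subgroup.closure {a, b}) : IsMetacyclic G := by
  induction hn : Nat.card G using Nat.strong_induction_on generalizing G with
  | _ n ih =>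
  have hgen := closure_pair_eq_top_of_forall_eq hbi
  by_cases hcom : Commute x y
  · exact isMetacyclic_of_closure_pair hgen (by simp [hcom.symm.eq])
  have hne : commutator G ≠ ⊥ := by
    intro h
    have hxy : ⁅x, y⁆ ∈ commutator G :=
      Subgroup.commutator_mem_commutator (Subgroup.mem_top x) (Subgroup.mem_top y)
    rw [h, Subgroup.mem_bot, commutatorElement_eq_one_iff_commute] at hxy
    exact hcom hxy
  obtain ⟨z, hzG, hz, hz1, hz2⟩ := hG.exists_central_involution hne
  have hc : ∀ g, Commute g z := fun g => Subgroup.mem_center_iff.1 hz g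
  have hZn : (Subgroup.zpowers z).Normal :=
    Subgroup.normal_of_conj_mem_of_closure_pair hgen
      (conj_zpow_mem_zpowers (by simp [(hc x).eq])) (conj_zpow_mem_zpowers (by simp [(hc y).eq]))
  have hMn : M.Normal := Subgroup.normal_of_index_eq_two hM
  have hZM : Subgroup.zpowers z ≤ M := by
    refine Subgroup.zpowers_le.2 ?_
    have : commutator G ≤ M := by
      rw [commutator_def, Subgroup.commutator_le]
      intro g _ h _
      simp only [commutatorElement_def, Subgroup.mul_mem_iff_of_index_two hM, inv_mem_iff]
      tauto
    exact this hzG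
  have hnot : ∀ g, g ∉ M → (g : G ⧸ Subgroup.zpowers z) ∉
      M.map (QuotientGroup.mk' (Subgroup.zpowers z)) := by
    rintro g hg ⟨m, hm, hmg⟩
    have := hZM (QuotientGroup.eq.1 hmg)
    exact hg ((Subgroup.mul_mem_cancel_left _ (inv_mem hm)).1 this)
  have hQ : IsMetacyclic (G ⧸ Subgroup.zpowers z) := by
    refine ih _ ?_ (hG.to_quotient _) (x := (x : G ⧸ _)) (y := (y : G ⧸ _)) ?_ ?_
      (hnot x hx) (hnot y hy) (a := (a : G ⧸ _)) (b := (b : G ⧸ _)) ?_ rfl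
    · rw [← hn, Subgroup.card_eq_card_quotient_mul_card_subgroup (Subgroup.zpowers z)]
      refine lt_mul_of_one_lt_right Nat.card_pos ?_
      have : Nontrivial (Subgroup.zpowers z) :=
        (Subgroup.nontrivial_iff_ne_bot _).2 (by simpa using hz1)
      exact Finite.one_lt_card
    · intro q
      obtain ⟨g, rfl⟩ := QuotientGroup.mk_surjective q
      obtain ⟨i, j, rfl⟩ := hbi g
      exact ⟨i, j, by simp⟩
    · rw [Subgroup.index_map_eq _ (QuotientGroup.mk'_surjective _) (by simpa using hZM), hM]
    · rw [hab, MonoidHom.map_closure, Set.image_pair]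
      rfl
  rcases isMetacyclic_or_commutator_le_of_quotient hG hz hz2 hzG hQ with h | h
  · exact h
  obtain ⟨i, hi⟩ := h (Subgroup.commutator_mem_commutator (Subgroup.mem_top x)
    (Subgroup.mem_top y))
  have hz2' : z ^ (2 : ℤ) = 1 := by exact_mod_cast hz2
  have hxy : x * y = z ^ i * (y * x) := by
    simp only at hi; rw [hi, commutatorElement_def]; group
  rcases Int.even_or_odd' i with ⟨t, rfl | rfl⟩
  · rw [zpow_mul, hz2', one_zpow, one_mul] at hxy
    exact absurd hxy hcom
  · rw [zpow_add_one, zpow_mul, hz2', one_zpow, one_mul] at hxy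
    refine isMetacyclic_of_mul_eq hG hbi hz hz1 hz2 ?_ hM hx hy hab
    rw [(hc _).eq, hxy, ← mul_assoc, ← pow_two, hz2, one_mul]

theorem isMetacyclic_of_zpowers_eq_top {G : Type*} [Group G] [Finite G] {x : G}
    (hx : Subgroup.zpowers x = ⊤) : IsMetacyclic G := by
  refine isMetacyclic_of_closure_pair (k := x) (g := 1) ?_ (by simp)
  rw [eq_top_iff, ← hx, Subgroup.zpowers_le]
  exact Subgroup.subset_closure (by simp)

/-- The maximal subgroup `⟨x⟩⟨y ^ 2⟩` of a bicyclic `2`-group `⟨x⟩⟨y⟩` is metacyclic, unless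
`⟨x⟩⟨y ^ 4⟩` is a subgroup containing the conjugates of `x` by powers of `y`. -/
theorem isMetacyclic_or_exists_conj_mem {G : Type*} [Group G] [Finite G]
    (hG : IsPGroup 2 G) {x y : G} (hbi : ∀ g : G, ∃ i j : ℤ, g = x ^ i * y ^ j)
    {M : Subgroup G} (hM : M.index = 2) (hx : x ∈ M) (hy : y ∉ M) {w : G}
    (hw : w ∈ Subgroup.zpowers y) :
    IsMetacyclic M ∨ ∃ L : Subgroup G, x ∈ L ∧ (∀ n : ℤ, y ^ n ∈ L ↔ 4 ∣ n) ∧ w * x * w⁻¹ ∈ L := by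
  have hMn : M.Normal := Subgroup.normal_of_index_eq_two hM
  set X : M := ⟨x, hx⟩ with hX
  set Y : M := ⟨y ^ 2, Subgroup.sq_mem_of_index_two hM y⟩ with hY
  have hYpow : ∀ n : ℤ, ((Y ^ n : M) : G) = y ^ (2 * n) := fun n => by
    rw [zpow_mul, zpow_ofNat]; simp [hY]
  have hbiM : ∀ m : M, ∃ i j : ℤ, m = X ^ i * Y ^ j := by
    rintro ⟨m, hm⟩
    obtain ⟨i, j, rfl⟩ := hbi m
    rw [Subgroup.mul_mem_cancel_left _ (zpow_mem hx i), zpow_mem_iff_even_of_index_two hM hy] at hm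
    obtain ⟨j, rfl⟩ := even_iff_two_dvd.1 hm
    exact ⟨i, j, Subtype.ext (by rw [Subgroup.coe_mul, hYpow]; simp [hX])⟩
  by_cases htop : Subgroup.zpowers X = ⊤
  · exact Or.inl (isMetacyclic_of_zpowers_eq_top htop)
  have hGM := hG.to_subgroup M
  obtain ⟨K, hXK, hK⟩ := hGM.exists_index_two_ge htop
  rw [Subgroup.zpowers_le] at hXK
  have hYK : Y ∉ K := by
    intro h
    have : K = ⊤ := by
      rw [eq_top_iff, ← closure_pair_eq_top_of_forall_eq hbiM, Subgroup.closure_le]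
      rintro a (rfl | rfl) <;> assumption
    simp [this] at hK
  have hKgen : K = Subgroup.closure {X, Y ^ 2} := by
    refine le_antisymm (fun m hm => ?_) ?_
    · obtain ⟨i, j, rfl⟩ := hbiM m
      rw [Subgroup.mul_mem_cancel_left _ (zpow_mem hXK i),
        zpow_mem_iff_even_of_index_two hK hYK] at hm
      obtain ⟨j, rfl⟩ := even_iff_two_dvd.1 hm
      rw [zpow_mul, zpow_ofNat]
      exact mul_mem (zpow_mem (Subgroup.subset_closure (by simp)) _)
        (zpow_mem (Subgroup.subset_closure (by simp)) _)
    · rw [Subgroup.closure_le]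
      rintro a (rfl | rfl)
      · exact hXK
      · exact Subgroup.sq_mem_of_index_two hK Y
  set σ : M ≃* M := MulAut.conjNormal w with hσ
  have hσY : σ Y = Y := by
    obtain ⟨n, rfl⟩ := hw
    refine Subtype.ext ?_
    rw [hσ, MulAut.conjNormal_apply, mul_inv_eq_iff_eq_mul]
    exact (((Commute.refl y).zpow_left n).pow_right 2).eq
  set K' := K.map (σ : M →* M) with hK'
  have hK'2 : K'.index = 2 := by rw [hK', Subgroup.index_map_equiv, hK]
  have hYK' : Y ∉ K' := by
    rintro ⟨m, hm, hmY⟩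
    exact hYK (σ.injective (hmY.trans hσY.symm) ▸ hm)
  by_cases hXK' : X ∈ K'
  · right
    refine ⟨K.map M.subtype, ⟨X, hXK, rfl⟩, fun n => ⟨?_, ?_⟩, ?_⟩
    · rintro ⟨m, hm, hmn⟩
      have hn : y ^ n ∈ M := hmn ▸ m.2
      rw [zpow_mem_iff_even_of_index_two hM hy] at hn
      obtain ⟨n, rfl⟩ := even_iff_two_dvd.1 hn
      have : m = Y ^ n := Subtype.ext (by rw [hYpow]; exact hmn)
      rw [this] at hm
      obtain ⟨n, rfl⟩ := even_iff_two_dvd.1 ((zpow_mem_iff_even_of_index_two hK hYK n).1 hm)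
      exact ⟨n, by ring⟩
    · rintro ⟨n, rfl⟩
      refine ⟨Y ^ (2 * n), (zpow_mem_iff_even_of_index_two hK hYK _).2 (even_two_mul n), ?_⟩
      rw [Subgroup.subtype_apply, hYpow]
      ring_nf
    · refine ⟨σ X, ?_, by simp [hσ, hX]⟩
      have hmem : σ X ∈ K' := ⟨X, hXK, rfl⟩
      obtain ⟨i, j, hij⟩ := hbiM (σ X)
      rw [hij] at hmem ⊢
      refine mul_mem (zpow_mem hXK i) ((zpow_mem_iff_even_of_index_two hK hYK j).2 ?_)
      exact (zpow_mem_iff_even_of_index_two hK'2 hYK' j).1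
        ((Subgroup.mul_mem_cancel_left _ (zpow_mem hXK' i)).1 hmem)
  · left
    refine isMetacyclic_of_index_two_closure_pair hGM hbiM hK'2 hXK' hYK'
      (a := σ X) (b := σ (Y ^ 2)) ?_
    rw [hK', hKgen, MonoidHom.map_closure, Set.image_pair]
    rfl

theorem isMetacyclic_of_commutator_eq {G : Type*} [Group G] [Finite G] (hG : IsPGroup 2 G)
    {x y : G} (hbi : ∀ g : G, ∃ i j : ℤ, g = x ^ i * y ^ j)
    {M₁ M₂ : Subgroup G} (hM₁ : M₁.index = 2) (hx₁ : x ∈ M₁) (hy₁ : y ∉ M₁)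
    (hM₂ : M₂.index = 2) (hx₂ : x ∉ M₂) (hy₂ : y ∈ M₂) {p q : ℤ}
    (hd : x⁻¹ * y * x * y⁻¹ = x ^ (4 * p) * y ^ (4 * q)) : IsMetacyclic G := by
  let M : Subgroup G :=
    { carrier := {g | g ∈ M₁ ↔ g ∈ M₂}
      one_mem' := by simp
      mul_mem' := fun {a b} ha hb => by
        simp only [Set.mem_ofPred_eq, Subgroup.mul_mem_iff_of_index_two hM₁,
          Subgroup.mul_mem_iff_of_index_two hM₂] at *
        tauto
      inv_mem' := fun {a} ha => by simpa using ha }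
  have hmem : ∀ g, g ∈ M ↔ (g ∈ M₁ ↔ g ∈ M₂) := fun g => Iff.rfl
  have hx : x ∉ M := by simp [hmem, hx₁, hx₂]
  have hy : y ∉ M := by simp [hmem, hy₁, hy₂]
  have hM : M.index = 2 := by
    refine Subgroup.index_eq_two_iff_exists_notMem_and.2 ⟨x, hx, fun b => ?_⟩
    simp only [hmem, Subgroup.mul_mem_iff_of_index_two hM₁, Subgroup.mul_mem_iff_of_index_two hM₂]
    tauto
  set X : M := ⟨x ^ 2, Subgroup.sq_mem_of_index_two hM x⟩ with hX
  set Y : M := ⟨y ^ 2, Subgroup.sq_mem_of_index_two hM y⟩ with hY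
  set U : M := ⟨x * y, (Subgroup.mul_mem_iff_of_index_two hM).2 (by simp [hx, hy])⟩ with hU
  have hXpow : ∀ n : ℤ, ((X ^ n : M) : G) = x ^ (2 * n) := fun n => by
    rw [zpow_mul, zpow_ofNat]; simp [hX]
  have hYpow : ∀ n : ℤ, ((Y ^ n : M) : G) = y ^ (2 * n) := fun n => by
    rw [zpow_mul, zpow_ofNat]; simp [hY]
  have htop : Subgroup.closure {U, X} = ⊤ := by
    by_contra hne
    obtain ⟨T, hT, hT2⟩ := (hG.to_subgroup M).exists_index_two_ge hne
    have hUT : U ∈ T := hT (Subgroup.subset_closure (by simp))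
    have hXT : X ∈ T := hT (Subgroup.subset_closure (by simp))
    have hYT : Y ∈ T := by
      have hUU : U ^ 2 = X * (X ^ (2 * p) * Y ^ (2 * q)) * Y := by
        refine Subtype.ext ?_
        simp only [Subgroup.coe_mul, hXpow, hYpow, ← mul_assoc]
        rw [show (2 * 2 : ℤ) = 4 by norm_num, mul_assoc _ (x ^ (4 * p)), ← hd]
        simp only [hU, hX, hY, Subgroup.coe_pow]
        rw [pow_two (x * y)]
        group
      have h1 := Subgroup.sq_mem_of_index_two hT2 U
      rw [hUU, Subgroup.mul_mem_cancel_left] at h1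
      · exact h1
      · refine mul_mem hXT (mul_mem (zpow_mem hXT _) ?_)
        rw [zpow_mul, zpow_ofNat]
        exact zpow_mem (Subgroup.sq_mem_of_index_two hT2 Y) q
    have : T = ⊤ := by
      rw [eq_top_iff]
      rintro ⟨m, hm⟩ -
      obtain ⟨i, j, rfl⟩ := hbi m
      have hm' := hm
      rw [Subgroup.mul_mem_iff_of_index_two hM, zpow_mem_iff_even_of_index_two hM hx,
        zpow_mem_iff_even_of_index_two hM hy] at hm'
      rcases Int.even_or_odd' j with ⟨s, rfl | rfl⟩
      · obtain ⟨r, rfl⟩ := even_iff_two_dvd.1 (hm'.2 (even_two_mul s))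
        have : (⟨x ^ (2 * r) * y ^ (2 * s), hm⟩ : M) = X ^ r * Y ^ s :=
          Subtype.ext (by rw [Subgroup.coe_mul, hXpow, hYpow])
        exact this ▸ mul_mem (zpow_mem hXT r) (zpow_mem hYT s)
      · obtain ⟨r, rfl⟩ := Int.not_even_iff_odd.1
          (mt hm'.1 (Int.not_even_iff_odd.2 (odd_two_mul_add_one s)))
        have : (⟨x ^ (2 * r + 1) * y ^ (2 * s + 1), hm⟩ : M) = X ^ r * U * Y ^ s := by
          refine Subtype.ext ?_
          rw [Subgroup.coe_mul, Subgroup.coe_mul, hXpow, hYpow, hU]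
          group
        exact this ▸ mul_mem (mul_mem (zpow_mem hXT r) hUT) (zpow_mem hYT s)
    simp [this] at hT2
  refine isMetacyclic_of_index_two_closure_pair hG hbi hM hx hy (a := U) (b := X) ?_
  have := congrArg (Subgroup.map M.subtype) htop
  rw [MonoidHom.map_closure, Set.image_pair, ← MonoidHom.range_eq_map, Subgroup.range_subtype]
    at this
  exact this.symm

theorem IsMetacyclic.top {G : Type*} [Group G] (h : IsMetacyclic G) :
    IsMetacyclic (⊤ : Subgroup G) :=
  h.of_injective (⊤ : Subgroup G).subtype (Subgroup.subtype_injective _)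

theorem exists_isMetacyclic_index_le_two {G : Type*} [Group G] [Finite G] (hG : IsPGroup 2 G)
    (hbi : IsBicyclic G) : ∃ M : Subgroup G, IsMetacyclic M ∧ M.index ≤ 2 := by
  obtain ⟨x, y, hbi⟩ := hbi
  have hof : IsMetacyclic G → ∃ M : Subgroup G, IsMetacyclic M ∧ M.index ≤ 2 :=
    fun h => ⟨⊤, h.top, by simp⟩
  have hgen := closure_pair_eq_top_of_forall_eq hbi
  by_cases htx : Subgroup.zpowers x = ⊤
  · exact hof (isMetacyclic_of_zpowers_eq_top htx)
  by_cases hty : Subgroup.zpowers y = ⊤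
  · exact hof (isMetacyclic_of_zpowers_eq_top hty)
  obtain ⟨M₁, hx₁, hM₁⟩ := hG.exists_index_two_ge htx
  obtain ⟨M₂, hy₂, hM₂⟩ := hG.exists_index_two_ge hty
  rw [Subgroup.zpowers_le] at hx₁ hy₂
  have hnot : ∀ M : Subgroup G, M.index = 2 → ¬(x ∈ M ∧ y ∈ M) := by
    rintro M hM ⟨hx, hy⟩
    have : M = ⊤ := by
      rw [eq_top_iff, ← hgen, Subgroup.closure_le]
      rintro a (rfl | rfl) <;> assumption
    simp [this] at hM
  have hy₁ : y ∉ M₁ := fun h => hnot M₁ hM₁ ⟨hx₁, h⟩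
  have hx₂ : x ∉ M₂ := fun h => hnot M₂ hM₂ ⟨h, hy₂⟩
  rcases isMetacyclic_or_exists_conj_mem hG hbi hM₁ hx₁ hy₁ (Subgroup.mem_zpowers y) with
    h | ⟨L, hxL, hyL, hL⟩
  · exact ⟨M₁, h, hM₁.le⟩
  rcases isMetacyclic_or_exists_conj_mem hG (forall_eq_zpow_mul_zpow_swap hbi) hM₂ hy₂ hx₂
    (inv_mem (Subgroup.mem_zpowers x)) with h | ⟨L', hyL', hxL', hL'⟩
  · exact ⟨M₂, h, hM₂.le⟩
  rw [inv_inv] at hL'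
  have hdL : x⁻¹ * y * x * y⁻¹ ∈ L := by
    simpa only [mul_assoc] using mul_mem (inv_mem hxL) hL
  have hdL' : x⁻¹ * y * x * y⁻¹ ∈ L' := mul_mem hL' (inv_mem hyL')
  obtain ⟨i, j, hd⟩ := hbi (x⁻¹ * y * x * y⁻¹)
  rw [hd] at hdL hdL'
  obtain ⟨q, rfl⟩ := (hyL j).1 ((Subgroup.mul_mem_cancel_left _ (zpow_mem hxL i)).1 hdL)
  obtain ⟨p, rfl⟩ := (hxL' i).1 ((Subgroup.mul_mem_cancel_right _ (zpow_mem hyL' _)).1 hdL')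
  exact hof (isMetacyclic_of_commutator_eq hG hbi hM₁ hx₁ hy₁ hM₂ hx₂ hy₂ hd)

/-- Every subgroup of a finite bicyclic `2`-group contains a metacyclic subgroup
of index at most `2`. -/
theorem subgroup_of_bicyclic_has_metacyclic_of_index_le_two (P : Type*) [Group P]
    [Finite P] (hP2 : IsPGroup 2 P) (hbi : IsBicyclic P) (H : Subgroup P) :
    ∃ M : Subgroup H, IsMetacyclic M ∧ M.index ≤ 2 := by
  obtain ⟨M, hM, hindex⟩ := exists_isMetacyclic_index_le_two hP2 hbi
  refine ⟨M.subgroupOf H, ?_, ?_⟩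
  · refine hM.of_injective
      ((H.subtype.comp (M.subgroupOf H).subtype).codRestrict M fun a => a.2) fun a b hab => ?_
    have hval := congrArg (Subtype.val : M → P) hab
    exact Subtype.ext (Subtype.ext hval)
  · have h := Subgroup.relIndex_le_of_le_right (H := M) (le_top : H ≤ ⊤)
      (by rw [Subgroup.relIndex_top_right]; exact Subgroup.index_ne_zero_of_finite)
    rw [Subgroup.relIndex_top_right] at h
    exact h.trans hindex
end
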